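/- Let E_n(T) = n^{-n} · Σ_{f ∈ Ω_n} T(f) be the expected value of T under the uniform distribution on Ω_n. Then log E_n(T) = k_0 · (n / log²n)^{1/3} · (1 + o(1)) as n → ∞; that is, log E_n(T) divided by k_0 · (n / log²n)^{1/3} tends to 1. -/

import Mathlib

open scoped Classical
open Function

namespace IterMap

noncomputable section

/-- A vertex `v` is cyclic for `f` if some positive iterate of `f` fixes `v`. -/
def IsCyclic {n : ℕ} (f : Fin n → Fin n) (v : Fin n) : Prop :=
  ∃ t, 0 < t ∧ f^[t] v = v

theorem isCyclic_apply {n : ℕ} {f : Fin n → Fin n} {v : Fin n} (h : IsCyclic f v) :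
    IsCyclic f (f v) := by
  obtain ⟨t, ht, hv⟩ := h
  refine ⟨t, ht, ?_⟩
  calc f^[t] (f v) = f^[t + 1] v := (Function.iterate_succ_apply f t v).symm
    _ = f (f^[t] v) := Function.iterate_succ_apply' f t v
    _ = f v := by rw [hv]

/-- The permutation induced by `f` on its cyclic vertices. -/
def cyclicPerm {n : ℕ} (f : Fin n → Fin n) :
    Equiv.Perm {v : Fin n // IsCyclic f v} :=
  Equiv.ofBijective (fun v => ⟨f v.1, isCyclic_apply v.2⟩) (by
    rw [← Finite.injective_iff_bijective]
    intro u v huv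
    have h1 : f u.1 = f v.1 := congrArg Subtype.val huv
    obtain ⟨s, hs, hsu⟩ := u.2
    obtain ⟨t, ht, htv⟩ := v.2
    have hu : f^[s * t] u.1 = u.1 := by
      rw [Function.iterate_mul]
      exact Function.iterate_fixed hsu t
    have hv : f^[s * t] v.1 = v.1 := by
      rw [mul_comm, Function.iterate_mul]
      exact Function.iterate_fixed htv s
    have hst : 0 < s * t := Nat.mul_pos hs ht
    obtain ⟨k, hk⟩ : ∃ k, s * t = k + 1 := ⟨s * t - 1, by omega⟩
    apply Subtype.ext
    calc u.1 = f^[s * t] u.1 := hu.symm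
      _ = f^[k] (f u.1) := by rw [hk, Function.iterate_succ_apply]
      _ = f^[k] (f v.1) := by rw [h1]
      _ = f^[s * t] v.1 := by rw [hk, Function.iterate_succ_apply]
      _ = v.1 := hv)

/-- `T f`: the (eventual) period of the sequence of iterates of `f`. -/
def T {n : ℕ} (f : Fin n → Fin n) : ℕ :=
  sInf {T : ℕ | 0 < T ∧ ∀ m, n ≤ m → f^[m + T] = f^[m]}

/-- `B f`: the product of the lengths of the cycles of `f`. -/
def B {n : ℕ} (f : Fin n → Fin n) : ℕ :=
  (cyclicPerm f).cycleType.prod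

/-- `Z f`: the number of cyclic vertices of `f`. -/
def Z {n : ℕ} (f : Fin n → Fin n) : ℕ :=
  Nat.card {v : Fin n // IsCyclic f v}

/-- `O f`: the number of distinct positive iterates of `f`. -/
def O {n : ℕ} (f : Fin n → Fin n) : ℕ :=
  Nat.card {g : Fin n → Fin n // ∃ t, 0 < t ∧ g = f^[t]}

/-- `f` is connected if its functional graph has one weak component. -/
def Connected {n : ℕ} (f : Fin n → Fin n) : Prop :=
  ∀ u v : Fin n, ∃ s t : ℕ, f^[s] u = f^[t] v

/-- The set of connected mappings on `[n]`. -/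
def Un (n : ℕ) : Finset (Fin n → Fin n) :=
  Finset.univ.filter fun f => Connected f

/-- `kappa n`: the average cycle length of a uniform random connected mapping. -/
def kappa (n : ℕ) : ℝ :=
  (∑ f ∈ Un n, (Z f : ℝ)) / (Un n).card

def c (d : ℕ) : ℝ :=
  ((kappa d - 1) / d) * Real.exp (-(d : ℝ)) *
    ∑ k ∈ Finset.range d, (d : ℝ) ^ k / (k.factorial : ℝ)

def F (z : ℝ) : ℝ := (1 / (1 - z)) * Real.exp (∑' d : ℕ, c d * z ^ d)

def mu (m : ℕ) : ℝ := iteratedDeriv m F 0 / (m.factorial : ℝ)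

def g (s : ℝ) : ℝ := ∑' d : ℕ, c d * Real.exp (-(d : ℝ) * s)

/-- `M m`: the average order of a uniform random permutation of `[m]`. -/
def M (m : ℕ) : ℝ :=
  (∑ σ : Equiv.Perm (Fin m), (orderOf σ : ℝ)) / (m.factorial : ℝ)

def I : ℝ :=
  ∫ t in Set.Ioi (0 : ℝ), Real.log (Real.log (Real.exp 1 / (1 - Real.exp (-t))))

def beta0 : ℝ := Real.sqrt (8 * I)

def k0 : ℝ := (3 / 2) * (3 * I) ^ ((2 : ℝ) / 3)

end

section PNT
open Real Set Filter Topology MeasureTheory Chebyshev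

/-- Fejér kernel -/
noncomputable def kf (w : ℝ) : ℝ := ∫ t in (0:ℝ)..1, (1 - t) * Real.cos (t * w)

lemma kf_eq {w : ℝ} (hw : w ≠ 0) : kf w = (1 - Real.cos w) / w ^ 2 := by
  unfold kf
  have h : ∀ t ∈ uIcc (0:ℝ) 1, HasDerivAt
      (fun t : ℝ => (1 - t) * (Real.sin (t * w) / w) - Real.cos (t * w) / w ^ 2)
      ((1 - t) * Real.cos (t * w)) t := by
    intro t _
    have h1 : HasDerivAt (fun t : ℝ => t * w) w t := by simpa using (hasDerivAt_id t).mul_const w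
    have h2 := (Real.hasDerivAt_sin (t * w)).comp t h1
    have h3 := (Real.hasDerivAt_cos (t * w)).comp t h1
    have h4 := (((hasDerivAt_id t).const_sub 1).mul (h2.div_const w)).sub (h3.div_const (w ^ 2))
    convert! h4 using 1
    simp
    field_simp
    ring
  rw [intervalIntegral.integral_eq_sub_of_hasDerivAt h (by
    apply Continuous.intervalIntegrable; fun_prop)]
  simp
  field_simp
  ring

lemma kf_zero : kf 0 = 1 / 2 := by
  unfold kf
  simp only [mul_zero, Real.cos_zero, mul_one]
  rw [intervalIntegral.integral_sub (by simp) (by simp)]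
  simp
  norm_num

lemma kf_nonneg (w : ℝ) : 0 ≤ kf w := by
  by_cases hw : w = 0
  · rw [hw, kf_zero]; norm_num
  · rw [kf_eq hw]
    have := Real.cos_le_one w
    apply div_nonneg <;> nlinarith [sq_nonneg w]

lemma kf_continuous : Continuous kf := by
  unfold kf
  apply intervalIntegral.continuous_parametric_intervalIntegral_of_continuous'
  fun_prop

lemma kf_le (w : ℝ) : kf w ≤ 3 * (1 + w ^ 2)⁻¹ := by
  have h1 : kf w ≤ 1 := by
    unfold kf
    calc ∫ t in (0:ℝ)..1, (1 - t) * Real.cos (t * w) ≤ ∫ t in (0:ℝ)..1, (1:ℝ) := by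
          apply intervalIntegral.integral_mono_on (by norm_num)
          · apply Continuous.intervalIntegrable; fun_prop
          · simp
          · intro t ht
            have := Real.cos_le_one (t * w)
            have := ht.1
            have := ht.2
            nlinarith
      _ = 1 := by simp
  rw [← div_eq_mul_inv, le_div_iff₀ (by positivity)]
  by_cases hw : w = 0
  · subst hw; nlinarith
  · have h2 : kf w * w ^ 2 = 1 - Real.cos w := by
      rw [kf_eq hw]; field_simp
    have := Real.neg_one_le_cos w
    nlinarith

lemma kf_integrable : Integrable kf := by
  refine (integrable_inv_one_add_sq.const_mul 3).mono' kf_continuous.aestronglyMeasurable ?_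
  filter_upwards with w
  rw [Real.norm_of_nonneg (kf_nonneg w)]
  exact kf_le w

lemma kf_integral_pos : 0 < ∫ w, kf w := by
  rw [integral_pos_iff_support_of_nonneg kf_nonneg kf_integrable]
  exact kf_continuous.isOpen_support.measure_pos volume ⟨0, by simp [kf_zero]⟩

/-- normalized psi -/
noncomputable def bB (u : ℝ) : ℝ := Real.exp (-u) * psi (Real.exp u)

lemma bB_nonneg (u : ℝ) : 0 ≤ bB u := mul_nonneg (exp_pos _).le (psi_nonneg _)

lemma bB_bound : ∃ C : ℝ, 1 ≤ C ∧ ∀ u, bB u ≤ C := by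
  refine ⟨Real.log 4 + 4, ?_, fun u => ?_⟩
  · have : 0 ≤ Real.log 4 := Real.log_nonneg (by norm_num)
    linarith
  · have := psi_le_const_mul_self (exp_pos u).le
    unfold bB
    calc _ ≤ Real.exp (-u) * ((Real.log 4 + 4) * Real.exp u) := by gcongr
      _ = (Real.log 4 + 4) * (Real.exp (-u) * Real.exp u) := by ring
      _ = _ := by rw [← Real.exp_add]; simp

lemma bB_mono {u v : ℝ} (h : u ≤ v) : bB u * Real.exp (-(v - u)) ≤ bB v := by
  unfold bB
  have h1 : psi (Real.exp u) ≤ psi (Real.exp v) := psi_mono (Real.exp_le_exp.mpr h)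
  calc _ = (Real.exp (-u) * Real.exp (-(v-u))) * psi (Real.exp u) := by ring
    _ = Real.exp (-v) * psi (Real.exp u) := by rw [← Real.exp_add]; ring_nf
    _ ≤ _ := by gcongr

lemma bB_measurable : Measurable bB := by
  unfold bB
  exact (by fun_prop : Measurable fun u : ℝ => Real.exp (-u)).mul
    (psi_mono.measurable.comp Real.measurable_exp)

noncomputable def HH (s : ℂ) : ℂ :=
  ArithmeticFunction.vonMangoldt.LFunctionResidueClassAux (1 : ZMod 1) s

lemma HH_cont : ContinuousOn HH {s | 1 ≤ s.re} :=
  ArithmeticFunction.vonMangoldt.continuousOn_LFunctionResidueClassAux (1 : ZMod 1)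

lemma HH_eq {s : ℂ} (hs : 1 < s.re) :
    LSeries (fun n => (ArithmeticFunction.vonMangoldt n : ℂ)) s = HH s + 1 / (s - 1) := by
  have := ArithmeticFunction.vonMangoldt.eqOn_LFunctionResidueClassAux (a := (1 : ZMod 1))
    isUnit_one hs
  unfold HH
  rw [this]
  have h2 : (fun n => ((ArithmeticFunction.vonMangoldt.residueClass (1 : ZMod 1) n : ℝ) : ℂ))
     = (fun n => (ArithmeticFunction.vonMangoldt n : ℂ)) := by
    ext n
    congr 1
    unfold ArithmeticFunction.vonMangoldt.residueClass
    rw [Set.indicator_of_mem]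
    exact Subsingleton.elim _ _
  simp [h2]

lemma psi_laplace {s : ℂ} (hs : 1 < s.re) :
    LSeries (fun n => (ArithmeticFunction.vonMangoldt n : ℂ)) s
      = s * ∫ u in Ioi (0:ℝ), (bB u : ℂ) * Complex.exp (-(s - 1) * u) := by
  rw [LSeries_eq_mul_integral _ zero_le_one hs
    (ArithmeticFunction.LSeriesSummable_vonMangoldt hs)]
  · congr 1
    have himg : Real.exp '' Ioi (0:ℝ) = Ioi 1 := by
      ext x
      constructor
      · rintro ⟨u, hu, rfl⟩
        exact Real.one_lt_exp_iff.mpr hu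
      · intro hx
        exact ⟨Real.log x, Real.log_pos hx, Real.exp_log (by linarith [mem_Ioi.mp hx])⟩
    rw [← himg, integral_image_eq_integral_abs_deriv_smul measurableSet_Ioi
      (fun x _ => (Real.hasDerivAt_exp x).hasDerivWithinAt) Real.exp_injective.injOn]
    apply setIntegral_congr_fun measurableSet_Ioi
    intro u hu
    simp only [bB]
    rw [psi_eq_sum_Icc]
    have : ∑ k ∈ Finset.Icc 0 ⌊Real.exp u⌋₊, ArithmeticFunction.vonMangoldt k
       = ∑ k ∈ Finset.Icc 1 ⌊Real.exp u⌋₊, ArithmeticFunction.vonMangoldt k := by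
      rw [← Finset.insert_Icc_add_one_left_eq_Icc (Nat.zero_le _), Finset.sum_insert (by simp)]
      simp
    rw [this]
    have he : ((Real.exp u : ℝ) : ℂ) ^ (-(s + 1)) = Complex.exp (-(s+1) * u) := by
      rw [Complex.cpow_def_of_ne_zero (by simp [Complex.exp_ne_zero]), ← Complex.ofReal_log (Real.exp_pos u).le, Real.log_exp]
      ring_nf
    rw [he, abs_of_pos (Real.exp_pos u)]
    simp only [Complex.real_smul]
    push_cast
    have e1 : Complex.exp (-(s+1) * u) = Complex.exp (-(u:ℂ)) * Complex.exp (-(u:ℂ)) * Complex.exp (-(s-1)*u) := by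
      rw [← Complex.exp_add, ← Complex.exp_add]; ring_nf
    rw [e1]
    have e2 : Complex.exp (u:ℂ) * Complex.exp (-(u:ℂ)) = 1 := by rw [← Complex.exp_add]; simp
    linear_combination (∑ k ∈ Finset.Icc 1 ⌊Real.exp u⌋₊, (ArithmeticFunction.vonMangoldt k : ℂ)) * Complex.exp (-(u:ℂ)) * Complex.exp (-(s-1)*u) * e2
  · apply Asymptotics.IsBigO.of_bound (Real.log 4 + 4)
    filter_upwards with n
    have h1 : ∑ k ∈ Finset.Icc 1 n, (ArithmeticFunction.vonMangoldt k : ℂ) = ((psi n : ℝ) : ℂ) := by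
      rw [psi_eq_sum_Icc, Nat.floor_natCast, ← Finset.insert_Icc_add_one_left_eq_Icc (Nat.zero_le _), Finset.sum_insert (by simp)]
      simp
    rw [h1]
    simp only [Complex.norm_real, Real.rpow_one, Real.norm_natCast]
    rw [Real.norm_of_nonneg (psi_nonneg _)]
    exact psi_le_const_mul_self (Nat.cast_nonneg n)
end PNT

section PNT
open Real Set Filter Topology MeasureTheory Chebyshev

noncomputable def GG (z : ℂ) : ℂ := (HH (1 + z) - 1) / (1 + z)

lemma GG_cont : ContinuousOn GG {z | 0 ≤ z.re} := by
  unfold GG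
  apply ContinuousOn.div
  · apply ContinuousOn.sub _ continuousOn_const
    refine HH_cont.comp (by fun_prop) ?_
    intro z hz
    simp only [mem_ofPred_eq] at *
    simpa using hz
  · fun_prop
  · intro z hz h
    have := congrArg Complex.re h
    simp only [mem_ofPred_eq] at *
    simp at this
    linarith

lemma int_exp {ε : ℝ} (hε : 0 < ε) : IntegrableOn (fun u : ℝ => Real.exp (-(ε * u))) (Ioi 0) := by
  have := exp_neg_integrableOn_Ioi 0 hε
  simpa [neg_mul] using this

lemma int_bexp {C : ℝ} {f : ℝ → ℝ} (hf : Measurable f) (hC : ∀ u, |f u| ≤ C) {z : ℂ} (hz : 0 < z.re) :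
    IntegrableOn (fun u : ℝ => (f u : ℂ) * Complex.exp (-z * u)) (Ioi 0) := by
  refine ((int_exp hz).const_mul C).mono' ?_ ?_
  · exact ((Complex.measurable_ofReal.comp hf).mul (by fun_prop)).aestronglyMeasurable
  · filter_upwards with u
    rw [norm_mul, Complex.norm_exp, Complex.norm_real, Real.norm_eq_abs]
    have : (-z * u).re = -(z.re * u) := by simp
    rw [this]
    gcongr
    exact hC u

lemma b_laplace {z : ℂ} (hz : 0 < z.re) :
    ∫ u in Ioi (0:ℝ), ((bB u - 1 : ℝ) : ℂ) * Complex.exp (-z * u) = GG z := by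
  obtain ⟨C, hC1, hC⟩ := bB_bound
  have hs : 1 < (1 + z).re := by simpa using hz
  have h1 := psi_laplace hs
  rw [HH_eq hs] at h1
  have h0 : (1 + z) ≠ 0 := by
    intro h; rw [h] at hs; simp at hs; linarith
  have hz0 : z ≠ 0 := by intro h; rw [h] at hz; simp at hz
  have h2 : ∫ u in Ioi (0:ℝ), Complex.exp (-z * u) = 1 / z := by
    rw [integral_exp_mul_complex_Ioi (by simpa using hz)]
    simp
  have e : ∀ u : ℝ, ((bB u - 1 : ℝ) : ℂ) * Complex.exp (-z * u)
     = (bB u : ℂ) * Complex.exp (-z * u) - Complex.exp (-z * u) := by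
    intro u; push_cast; ring
  simp_rw [e]
  rw [integral_sub, h2]
  · simp only [add_sub_cancel_left] at h1
    unfold GG
    rw [eq_div_iff h0]
    have : (1 + z) * (1 / z) = 1 / z + 1 := by field_simp
    linear_combination -h1 - this
  · exact int_bexp bB_measurable (C := C) (fun u => by rw [abs_of_nonneg (bB_nonneg u)]; exact hC u) hz
  · have := int_bexp (f := fun _ => 1) measurable_const (C := 1) (fun u => by simp) hz
    simpa [IntegrableOn] using this

lemma b_smooth_eps {ε : ℝ} (hε : 0 < ε) (l v : ℝ) :
    ∫ u in Ioi (0:ℝ), (bB u - 1) * Real.exp (-(ε * u)) * kf (l * (v - u))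
     = ∫ t in (0:ℝ)..1, (1 - t) *
        (Complex.exp (Complex.I * (l * t * v)) * GG (ε + Complex.I * (l * t))).re := by
  obtain ⟨C, hC1, hC⟩ := bB_bound
  have hbd : ∀ u, |bB u - 1| ≤ C := fun u => by
    have := bB_nonneg u
    have := hC u
    rw [abs_le]; constructor <;> linarith
  have hmeas : Measurable fun u => bB u - 1 := bB_measurable.sub_const 1
  unfold kf
  simp_rw [← intervalIntegral.integral_const_mul]
  simp_rw [intervalIntegral.integral_of_le (zero_le_one (α := ℝ))]
  rw [integral_integral_swap]
  · apply setIntegral_congr_fun measurableSet_Ioc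
    intro t ht
    simp only
    have hz : 0 < ((ε:ℂ) + Complex.I * (l * t)).re := by simpa using hε
    rw [← b_laplace hz, ← integral_const_mul]
    have hint := (int_bexp hmeas hbd hz).const_mul (Complex.exp (Complex.I * (l * t * v)))
    have := Complex.reCLM.integral_comp_comm hint
    simp only [Complex.reCLM_apply] at this
    rw [← this, ← integral_const_mul]
    apply setIntegral_congr_fun measurableSet_Ioi
    intro u hu
    simp only
    have e1 : Complex.exp (Complex.I * (l * t * v)) *
        (((bB u - 1 : ℝ) : ℂ) * Complex.exp (-((ε:ℂ) + Complex.I * (l * t)) * u)) =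
        ((bB u - 1 : ℝ) : ℂ) * ((Real.exp (-(ε * u)) : ℝ) : ℂ) * Complex.exp (((t * (l * (v - u)) : ℝ) : ℂ) * Complex.I) := by
      push_cast
      rw [mul_left_comm, ← Complex.exp_add, mul_assoc ((bB u : ℂ) - 1), ← Complex.exp_add]
      ring_nf
    rw [e1, ← Complex.ofReal_mul, Complex.re_ofReal_mul, Complex.exp_ofReal_mul_I_re]
    ring
  · have : Integrable (fun p : ℝ × ℝ => (C * Real.exp (-(ε * p.1))) * 1) ((volume.restrict (Ioi 0)).prod (volume.restrict (Ioc (0:ℝ) 1))) := by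
      apply Integrable.mul_prod (f := fun u => C * Real.exp (-(ε * u))) (g := fun _ => (1:ℝ))
      · exact (int_exp hε).const_mul C
      · simp
    refine this.mono' ?_ ?_
    · apply Measurable.aestronglyMeasurable
      simp only [uncurry_def]
      have : Measurable (fun p : ℝ × ℝ => bB p.1 - 1) := hmeas.comp measurable_fst
      fun_prop
    · have h2 : ∀ᵐ p ∂((volume.restrict (Ioi (0:ℝ))).prod (volume.restrict (Ioc (0:ℝ) 1))), p.2 ∈ Ioc (0:ℝ) 1 := by
        rw [Measure.prod_restrict]
        filter_upwards [ae_restrict_mem (measurableSet_Ioi.prod measurableSet_Ioc)] with p hp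
        exact hp.2
      filter_upwards [h2] with p hp
      simp only [uncurry_def, norm_mul, Real.norm_eq_abs, abs_exp]
      have a1 := hbd p.1
      have a2 := Real.abs_cos_le_one (p.2 * (l * (v - p.1)))
      have a3 : |1 - p.2| ≤ 1 := by rw [abs_le]; constructor <;> linarith [hp.1, hp.2]
      have a4 : |1 - p.2| * |Real.cos (p.2 * (l * (v - p.1)))| ≤ 1 := by
        calc _ ≤ (1:ℝ) * 1 := by gcongr
          _ = 1 := by norm_num
      gcongr
end PNT

section PNT
open Real Set Filter Topology MeasureTheory Chebyshev

lemma kf_int_shift {l : ℝ} (hl : 0 < l) (v : ℝ) : Integrable (fun u => kf (l * (v - u))) := by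
  have h1 := (kf_integrable.comp_mul_left' hl.ne')
  exact h1.comp_sub_left v

lemma GG_tendsto (l t : ℝ) :
    Tendsto (fun ε : ℝ => GG (ε + Complex.I * (l * t))) (𝓝[>] 0) (𝓝 (GG (Complex.I * (l * t)))) := by
  have h0 : (Complex.I * (l * t)) ∈ {z : ℂ | 0 ≤ z.re} := by
    rw [mem_ofPred_eq]; simp
  have h1 : Tendsto (fun ε : ℝ => (ε : ℂ) + Complex.I * (l * t)) (𝓝[>] 0) (𝓝[{z : ℂ | 0 ≤ z.re}] (Complex.I * (l * t))) := by
    apply tendsto_nhdsWithin_of_tendsto_nhds_of_eventually_within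
    · have : Continuous (fun ε : ℝ => (ε : ℂ) + Complex.I * (l * t)) := by fun_prop
      have := (this.tendsto 0).mono_left (nhdsWithin_le_nhds (s := Ioi 0))
      simpa using this
    · filter_upwards [self_mem_nhdsWithin] with ε hε
      rw [mem_Ioi] at hε
      simpa using hε.le
  exact (GG_cont _ h0).tendsto.comp h1

set_option maxHeartbeats 1000000 in
lemma b_smooth {l : ℝ} (hl : 0 < l) (v : ℝ) :
    ∫ u in Ioi (0:ℝ), (bB u - 1) * kf (l * (v - u))
     = ∫ t in (0:ℝ)..1, (1 - t) *
        (Complex.exp (Complex.I * (l * t * v)) * GG (Complex.I * (l * t))).re := by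
  obtain ⟨C, hC1, hC⟩ := bB_bound
  have hbd : ∀ u, |bB u - 1| ≤ C := fun u => by
    have := bB_nonneg u
    have := hC u
    rw [abs_le]; constructor <;> linarith
  have hmeas : Measurable fun u => bB u - 1 := bB_measurable.sub_const 1
  have hkm := kf_continuous.measurable
  have L : Tendsto (fun ε : ℝ => ∫ u in Ioi (0:ℝ), (bB u - 1) * Real.exp (-(ε * u)) * kf (l * (v - u)))
      (𝓝[>] 0) (𝓝 (∫ u in Ioi (0:ℝ), (bB u - 1) * kf (l * (v - u)))) := by
    apply tendsto_integral_filter_of_dominated_convergence (fun u => C * kf (l * (v - u)))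
    · filter_upwards with ε
      apply Measurable.aestronglyMeasurable
      fun_prop
    · filter_upwards [self_mem_nhdsWithin] with ε hε
      filter_upwards [ae_restrict_mem measurableSet_Ioi] with u hu
      simp only [mem_Ioi] at hε hu
      rw [norm_mul, norm_mul, Real.norm_of_nonneg (kf_nonneg _), Real.norm_of_nonneg (exp_pos _).le, Real.norm_eq_abs]
      have : Real.exp (-(ε * u)) ≤ 1 := by
        rw [Real.exp_le_one_iff]; nlinarith
      have h0 := kf_nonneg (l * (v - u))
      calc _ ≤ C * 1 * kf (l * (v - u)) := by
            gcongr
            exact hbd u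
        _ = _ := by ring
    · exact ((kf_int_shift hl v).const_mul C).integrableOn
    · filter_upwards with u
      have : Continuous (fun ε : ℝ => (bB u - 1) * Real.exp (-(ε * u)) * kf (l * (v - u))) := by fun_prop
      have := (this.tendsto 0).mono_left (nhdsWithin_le_nhds (s := Ioi 0))
      simpa using this
  have hcomp : IsCompact ((fun p : ℝ × ℝ => (p.1 : ℂ) + Complex.I * (l * p.2)) '' (Icc 0 1 ×ˢ Icc 0 1)) :=
    (isCompact_Icc.prod isCompact_Icc).image (by fun_prop)
  obtain ⟨M, hM⟩ := hcomp.exists_bound_of_continuousOn (f := GG) (GG_cont.mono (by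
    rintro z ⟨p, hp, rfl⟩
    simpa using hp.1.1))
  have hM' : ∀ ε ∈ Icc (0:ℝ) 1, ∀ t ∈ Icc (0:ℝ) 1, ‖GG (ε + Complex.I * (l * t))‖ ≤ M := by
    intro ε hε t ht
    exact hM _ ⟨(ε, t), ⟨hε, ht⟩, rfl⟩
  have R : Tendsto (fun ε : ℝ => ∫ t in (0:ℝ)..1, (1 - t) *
        (Complex.exp (Complex.I * (l * t * v)) * GG (ε + Complex.I * (l * t))).re)
      (𝓝[>] 0) (𝓝 (∫ t in (0:ℝ)..1, (1 - t) *
        (Complex.exp (Complex.I * (l * t * v)) * GG (Complex.I * (l * t))).re)) := by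
    apply intervalIntegral.tendsto_integral_filter_of_dominated_convergence (fun _ => M)
    · filter_upwards [self_mem_nhdsWithin] with ε hε
      simp only [mem_Ioi] at hε
      apply Continuous.aestronglyMeasurable
      have : Continuous fun t : ℝ => GG (ε + Complex.I * (l * t)) := by
        rw [← continuousOn_univ]
        refine GG_cont.comp (by fun_prop) ?_
        intro t _
        simpa using hε.le
      fun_prop
    · filter_upwards [Ioc_mem_nhdsGT (zero_lt_one (α := ℝ))] with ε hε
      filter_upwards with t ht
      rw [uIoc_of_le zero_le_one] at ht
      rw [norm_mul]
      have h1 : ‖1 - t‖ ≤ 1 := by rw [Real.norm_eq_abs, abs_le]; constructor <;> linarith [ht.1, ht.2]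
      have h2 : ‖(Complex.exp (Complex.I * (l * t * v)) * GG (ε + Complex.I * (l * t))).re‖ ≤ M := by
        refine (Complex.abs_re_le_norm _).trans ?_
        rw [norm_mul, Complex.norm_exp]
        simp only [Complex.mul_re, Complex.I_re, Complex.I_im, Complex.mul_im, Complex.ofReal_re, Complex.ofReal_im]
        simpa using hM' ε ⟨hε.1.le, hε.2⟩ t ⟨ht.1.le, ht.2⟩
      calc _ ≤ 1 * M := by gcongr
        _ = M := one_mul M
    · simp
    · filter_upwards with t ht
      have hc' := GG_tendsto l t
      exact ((Complex.continuous_re.tendsto _).comp (hc'.const_mul _)).const_mul _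
  refine tendsto_nhds_unique L (R.congr' ?_)
  filter_upwards [self_mem_nhdsWithin] with ε hε
  exact (b_smooth_eps hε l v).symm

lemma b_smooth_tendsto {l : ℝ} (hl : 0 < l) :
    Tendsto (fun v => ∫ u in Ioi (0:ℝ), (bB u - 1) * kf (l * (v - u))) atTop (𝓝 0) := by
  simp_rw [b_smooth hl]
  set f : ℝ → ℂ := fun t => (Ioc (0:ℝ) 1).indicator (fun t : ℝ => ((1 - t : ℝ) : ℂ) * GG (Complex.I * (l * t))) t with hf
  have h1 := Real.tendsto_integral_exp_smul_cocompact f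
  have h2 : Tendsto (fun v : ℝ => -(l * v / (2 * π))) atTop (cocompact ℝ) := by
    have : Tendsto (fun v : ℝ => -(l * v / (2 * π))) atTop atBot := by
      apply tendsto_neg_atTop_atBot.comp
      exact (tendsto_id.const_mul_atTop hl).atTop_div_const (by positivity)
    exact this.mono_right atBot_le_cocompact
  have h3 := ((Complex.continuous_re.tendsto _).comp (h1.comp h2))
  simp only [Complex.zero_re] at h3
  refine h3.congr fun v => ?_
  simp only [comp_def]
  have hc : Continuous fun t : ℝ => GG (Complex.I * (l * t)) := by
    rw [← continuousOn_univ]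
    refine GG_cont.comp (by fun_prop) ?_
    intro t _
    simp
  have e : ∀ t : ℝ, Real.fourierChar (-(t * -(l * v / (2 * π)))) • f t =
     (Ioc (0:ℝ) 1).indicator (fun t : ℝ => ((1 - t : ℝ) : ℂ) * (Complex.exp (Complex.I * (l * t * v)) * GG (Complex.I * (l * t)))) t := by
    intro t
    by_cases ht : t ∈ Ioc (0:ℝ) 1
    · simp only [hf, indicator_of_mem ht, Circle.smul_def, Real.fourierChar_apply, smul_eq_mul]
      have : ((2 * π * -(t * -(l * v / (2 * π))) : ℝ) : ℂ) * Complex.I = Complex.I * (l * t * v) := by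
        have hp : (π:ℂ) ≠ 0 := by exact_mod_cast pi_ne_zero
        push_cast
        field_simp
      rw [this]; ring
    · simp [hf, indicator_of_notMem ht]
  simp_rw [e]
  rw [integral_indicator measurableSet_Ioc, intervalIntegral.integral_of_le zero_le_one]
  have hint : Integrable (fun t : ℝ => ((1 - t : ℝ) : ℂ) * (Complex.exp (Complex.I * (l * t * v)) * GG (Complex.I * (l * t)))) (volume.restrict (Ioc 0 1)) := by
    have : IntegrableOn (fun t : ℝ => ((1 - t : ℝ) : ℂ) * (Complex.exp (Complex.I * (l * t * v)) * GG (Complex.I * (l * t)))) (Icc 0 1) := by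
      apply Continuous.integrableOn_Icc
      fun_prop
    exact this.mono_set Ioc_subset_Icc_self
  have := Complex.reCLM.integral_comp_comm hint
  simp only [Complex.reCLM_apply] at this
  rw [← this]
  simp_rw [Complex.re_ofReal_mul]
end PNT

section PNT
open Real Set Filter Topology MeasureTheory Chebyshev

lemma int_bk {k : ℝ → ℝ} (hk : Integrable k) : Integrable (fun u => bB u * k u) := by
  obtain ⟨C, hC1, hC⟩ := bB_bound
  exact hk.bdd_mul bB_measurable.aestronglyMeasurable (c := C)
    (Eventually.of_forall fun u => by rw [Real.norm_of_nonneg (bB_nonneg u)]; exact hC u)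

lemma win_int (k : ℝ → ℝ) (v d : ℝ) (hd : 0 < d) :
    ∫ u in Icc (v - d) (v + d), k (v - u) = ∫ w in (-d)..d, k w := by
  rw [integral_Icc_eq_integral_Ioc, ← intervalIntegral.integral_of_le (by linarith),
    intervalIntegral.integral_comp_sub_left]
  congr 1 <;> ring

lemma taub_upper {k : ℝ → ℝ} (hk : Integrable k) (hk0 : ∀ w, 0 ≤ k w) {d v : ℝ} (hd : 0 < d) (hv : 0 < v) :
    bB v * Real.exp (-(2 * d)) * (∫ w in (-d)..d, k w) ≤ ∫ u in Ioi 0, bB u * k (v + d - u) := by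
  have hk' := hk.comp_sub_left (v + d)
  have hi := int_bk hk'
  rw [← win_int k (v + d) d hd, ← integral_const_mul]
  calc _ ≤ ∫ u in Icc (v + d - d) (v + d + d), bB u * k (v + d - u) := by
        apply setIntegral_mono_on (hk'.integrableOn.const_mul _) hi.integrableOn measurableSet_Icc
        intro u hu
        apply mul_le_mul_of_nonneg_right _ (hk0 _)
        have h1 := bB_mono (u := v) (v := u) (by linarith [hu.1])
        refine le_trans ?_ h1
        apply mul_le_mul_of_nonneg_left _ (bB_nonneg _)
        rw [Real.exp_le_exp]
        linarith [hu.2]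
    _ ≤ _ := by
        apply setIntegral_mono_set hi.integrableOn
        · filter_upwards with u
          exact mul_nonneg (bB_nonneg _) (hk0 _)
        · apply LE.le.eventuallyLE
          intro u hu
          rw [mem_Ioi]
          linarith [hu.1]

lemma taub_lower {k : ℝ → ℝ} (hk : Integrable k) (hk0 : ∀ w, 0 ≤ k w) {d v C : ℝ} (hd : 0 < d)
     (hC : ∀ u, bB u ≤ C) :
    ∫ u in Ioi 0, bB u * k (v - d - u) ≤ bB v * Real.exp (2 * d) * (∫ w in (-d)..d, k w)
      + C * ((∫ w, k w) - ∫ w in (-d)..d, k w) := by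
  have hk' := hk.comp_sub_left (v - d)
  have hi := int_bk hk'
  set A := Icc (v - d - d) (v - d + d)
  have hA : MeasurableSet A := measurableSet_Icc
  have e : ∫ w, k w = ∫ u, k (v - d - u) := (integral_sub_left_eq_self k volume (v - d)).symm
  rw [← win_int k (v - d) d hd, e, ← integral_indicator hA]
  have hind := hk'.indicator hA
  have hsub : Integrable (fun u => k (v - d - u) - A.indicator (fun t => k (v - d - t)) u) := hk'.sub hind
  rw [← integral_const_mul, ← integral_sub hk' hind, ← integral_const_mul, ← integral_add (hind.const_mul _) (hsub.const_mul _)]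
  calc _ ≤ ∫ u, bB u * k (v - d - u) :=
        setIntegral_le_integral hi (Eventually.of_forall fun u => mul_nonneg (bB_nonneg _) (hk0 _))
    _ ≤ _ := by
        apply integral_mono hi ((hind.const_mul _).add (hsub.const_mul _))
        intro u
        simp only [Pi.add_apply]
        by_cases hu : u ∈ A
        · rw [indicator_of_mem hu]
          simp only [sub_self, mul_zero, add_zero]
          apply mul_le_mul_of_nonneg_right _ (hk0 _)
          have hu' : v - d - d ≤ u ∧ u ≤ v - d + d := hu
          have h1 := bB_mono (u := u) (v := v) (by linarith [hu'.2])
          have h2 : bB u ≤ bB v * Real.exp (v - u) := by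
            calc bB u = bB u * Real.exp (-(v - u)) * Real.exp (v - u) := by
                  rw [mul_assoc, ← Real.exp_add]; simp
              _ ≤ _ := by gcongr
          refine h2.trans ?_
          apply mul_le_mul_of_nonneg_left _ (bB_nonneg _)
          rw [Real.exp_le_exp]
          linarith [hu'.1]
        · rw [indicator_of_notMem hu]
          simp only [mul_zero, zero_add, sub_zero]
          exact mul_le_mul_of_nonneg_right (hC u) (hk0 _)

lemma S_tendsto {l : ℝ} (hl : 0 < l) :
    Tendsto (fun v => ∫ u in Ioi (0:ℝ), bB u * kf (l * (v - u))) atTop (𝓝 (∫ w, kf (l * w))) := by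
  have hk : Integrable (fun w => kf (l * w)) := kf_integrable.comp_mul_left' hl.ne'
  have h1 := b_smooth_tendsto hl
  have h2 : Tendsto (fun v => ∫ u in Ioi (0:ℝ), kf (l * (v - u))) atTop (𝓝 (∫ w, kf (l * w))) := by
    have e : ∀ v, ∫ u in Ioi (0:ℝ), kf (l * (v - u)) = ∫ w, (Iio v).indicator (fun w => kf (l * w)) w := by
      intro v
      rw [← integral_indicator measurableSet_Ioi, ← integral_sub_left_eq_self (fun w => (Iio v).indicator (fun w => kf (l * w)) w) volume v]
      congr 1
      ext u
      simp only [indicator, mem_Ioi, mem_Iio, sub_lt_self_iff]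
    simp_rw [e]
    apply tendsto_integral_filter_of_dominated_convergence (fun w => kf (l * w))
    · filter_upwards with v
      exact (hk.indicator measurableSet_Iio).aestronglyMeasurable
    · filter_upwards with v
      filter_upwards with w
      refine (norm_indicator_le_norm_self _ _).trans ?_
      rw [Real.norm_of_nonneg (kf_nonneg _)]
    · exact hk
    · filter_upwards with w
      apply tendsto_const_nhds.congr'
      filter_upwards [eventually_gt_atTop w] with v hv
      rw [indicator_of_mem (mem_Iio.mpr hv)]
  have := h1.add h2
  rw [zero_add] at this
  refine this.congr fun v => ?_
  have hk' := kf_int_shift hl v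
  have hi := int_bk hk'
  rw [← integral_add ((hi.sub hk').integrableOn.congr (Eventually.of_forall fun u => by simp; ring)) hk'.integrableOn]
  congr 1
  ext u; ring

lemma bB_tendsto : Tendsto bB atTop (𝓝 1) := by
  obtain ⟨C, hC1, hC⟩ := bB_bound
  set c := ∫ w, kf w with hc
  have hc0 : 0 < c := kf_integral_pos
  -- ratio
  set r : ℝ → ℝ := fun d => (∫ w in (-d⁻¹)..d⁻¹, kf w) / c with hr
  have hr1 : Tendsto r (𝓝[>] 0) (𝓝 1) := by
    have h := intervalIntegral_tendsto_integral kf_integrable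
      (tendsto_neg_atTop_atBot.comp (tendsto_inv_nhdsGT_zero (𝕜 := ℝ))) tendsto_inv_nhdsGT_zero
    have := h.div_const c
    rw [← hc, div_self hc0.ne'] at this
    exact this
  have he : Tendsto (fun d : ℝ => Real.exp (2 * d)) (𝓝[>] 0) (𝓝 1) := by
    have : Continuous (fun d : ℝ => Real.exp (2 * d)) := by fun_prop
    simpa using (this.tendsto 0).mono_left (nhdsWithin_le_nhds (s := Ioi 0))
  have hup : Tendsto (fun d => Real.exp (2 * d) / r d) (𝓝[>] 0) (𝓝 1) := by
    simpa [Pi.div_def] using he.div hr1 one_ne_zero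
  have hlo : Tendsto (fun d => (1 - C * (1 - r d)) / Real.exp (2 * d)) (𝓝[>] 0) (𝓝 1) := by
    simpa [Pi.div_def] using (((hr1.const_sub 1).const_mul C).const_sub 1).div he one_ne_zero
  -- facts for fixed d
  have key : ∀ d : ℝ, 0 < d → (∫ w in (-d)..d, kf ((d^2)⁻¹ * w)) = (∫ w, kf ((d^2)⁻¹ * w)) * r d ∧ 0 < ∫ w, kf ((d^2)⁻¹ * w) := by
    intro d hd
    have hl : 0 < (d^2)⁻¹ := by positivity
    rw [intervalIntegral.integral_comp_mul_left _ hl.ne', Measure.integral_comp_mul_left kf, ← hc]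
    have e1 : (d^2)⁻¹ * d = d⁻¹ := by field_simp
    rw [mul_neg, e1, abs_of_pos (by positivity)]
    refine ⟨?_, by rw [smul_eq_mul]; positivity⟩
    simp only [smul_eq_mul, hr]
    field_simp
  have hr_le : ∀ d, 0 < d → r d ≤ 1 := by
    intro d hd
    rw [hr]
    simp only
    rw [div_le_one hc0, intervalIntegral.integral_of_le (by have := inv_pos.mpr hd; linarith)]
    exact setIntegral_le_integral kf_integrable (Eventually.of_forall kf_nonneg)
  rw [tendsto_order]
  constructor
  · intro a ha
    obtain ⟨d, hd1, hd0⟩ := ((hlo.eventually (lt_mem_nhds ha)).and self_mem_nhdsWithin).exists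
    replace hd0 : 0 < d := hd0
    obtain ⟨k1, k2⟩ := key d hd0
    have hl : 0 < (d^2)⁻¹ := by positivity
    set q := ∫ w, kf ((d^2)⁻¹ * w) with hq
    have hk : Integrable (fun w => kf ((d^2)⁻¹ * w)) := kf_integrable.comp_mul_left' hl.ne'
    have hS := (S_tendsto hl).comp (tendsto_atTop_add_const_right atTop (-d) tendsto_id)
    rw [← hq] at hS
    have hS2 := ((hS.sub_const (C * (q - q * r d))).div_const (q * Real.exp (2 * d)))
    have e : (q - C * (q - q * r d)) / (q * Real.exp (2 * d)) = (1 - C * (1 - r d)) / Real.exp (2 * d) := by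
      field_simp
    rw [e] at hS2
    filter_upwards [hS2.eventually (lt_mem_nhds hd1)] with v hv
    refine hv.trans_le ?_
    rw [div_le_iff₀ (by positivity)]
    have := taub_lower hk (fun w => kf_nonneg _) hd0 hC (v := v)
    rw [k1, ← hq] at this
    have h3 : bB v * Real.exp (2 * d) * (q * r d) ≤ bB v * (q * Real.exp (2 * d)) := by
      have := hr_le d hd0
      have hb := bB_nonneg v
      calc bB v * Real.exp (2 * d) * (q * r d) ≤ bB v * Real.exp (2 * d) * (q * 1) := by gcongr
        _ = _ := by ring
    simp only [comp_apply, id, ← sub_eq_add_neg]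
    linarith
  · intro a ha
    obtain ⟨d, ⟨hd1, hrp⟩, hd0⟩ := (((hup.eventually (gt_mem_nhds ha)).and (hr1.eventually (lt_mem_nhds one_pos))).and self_mem_nhdsWithin).exists
    replace hd0 : 0 < d := hd0
    obtain ⟨k1, k2⟩ := key d hd0
    have hl : 0 < (d^2)⁻¹ := by positivity
    set q := ∫ w, kf ((d^2)⁻¹ * w) with hq
    have hk : Integrable (fun w => kf ((d^2)⁻¹ * w)) := kf_integrable.comp_mul_left' hl.ne'
    have hS := (S_tendsto hl).comp (tendsto_atTop_add_const_right atTop d tendsto_id)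
    rw [← hq] at hS
    have hS2 := (hS.mul_const (Real.exp (2 * d) / (q * r d)))
    have e : q * (Real.exp (2 * d) / (q * r d)) = Real.exp (2 * d) / r d := by
      field_simp
    rw [e] at hS2
    filter_upwards [hS2.eventually (gt_mem_nhds hd1), eventually_gt_atTop 0] with v hv hv0
    refine lt_of_le_of_lt ?_ hv
    have := taub_upper hk (fun w => kf_nonneg _) hd0 hv0
    rw [k1] at this
    simp only [comp_apply, id]
    rw [← mul_div_assoc, le_div_iff₀ (by positivity)]
    calc bB v * (q * r d) = bB v * Real.exp (-(2 * d)) * (q * r d) * Real.exp (2 * d) := by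
          have : Real.exp (-(2 * d)) * Real.exp (2 * d) = 1 := by rw [← Real.exp_add]; simp
          linear_combination (-(bB v * (q * r d))) * this
      _ ≤ _ := by gcongr

lemma psi_div_tendsto : Tendsto (fun x : ℝ => psi x / x) atTop (𝓝 1) := by
  have := bB_tendsto.comp Real.tendsto_log_atTop
  refine this.congr' ?_
  filter_upwards [eventually_gt_atTop 0] with x hx
  simp only [comp_apply, bB]
  rw [Real.exp_neg, Real.exp_log hx]
  ring

lemma theta_div_tendsto : Tendsto (fun x : ℝ => theta x / x) atTop (𝓝 1) := by
  have h1 : (fun x => psi x - theta x) =o[atTop] (fun x : ℝ => x) := by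
    refine isBigO_psi_sub_theta_sqrt.trans_isLittleO ?_
    rw [Asymptotics.isLittleO_iff_tendsto' (by filter_upwards [eventually_gt_atTop 0] with x hx h; exact absurd h hx.ne')]
    have := (tendsto_inv_atTop_zero.comp Real.tendsto_sqrt_atTop)
    refine this.congr fun x => ?_
    simp only [comp_apply]
    rw [Real.sqrt_div_self', one_div]
  have := psi_div_tendsto.sub h1.tendsto_div_nhds_zero
  rw [sub_zero] at this
  refine this.congr fun x => ?_
  ring
end PNT

section Comb
open Finset

noncomputable def ak {n : ℕ} (f : Fin n → Fin n) (k : ℕ) : ℕ :=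
  (univ.filter (fun v => minimalPeriod f v = k)).card

lemma minPer_le {n : ℕ} (f : Fin n → Fin n) (v : Fin n) : minimalPeriod f v ≤ n := by
  have h := Finset.card_le_card_of_injOn (s := range (minimalPeriod f v)) (t := (univ : Finset (Fin n)))
    (fun i => f^[i] v) (fun i _ => by simp) (by
      intro i hi j hj hij
      exact iterate_injOn_Iio_minimalPeriod (by simpa using hi) (by simpa using hj) hij)
  simpa using h

lemma ak_ge {n : ℕ} {f : Fin n → Fin n} {v : Fin n} {k : ℕ} (hk : 0 < k) (hv : minimalPeriod f v = k) :
    k ≤ ak f k := by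
  have h := Finset.card_le_card_of_injOn (s := range (minimalPeriod f v))
    (t := univ.filter (fun v => minimalPeriod f v = k))
    (fun i => f^[i] v) (fun i _ => by
      simp only [coe_filter, mem_univ, true_and]
      show minimalPeriod f (f^[i] v) = k
      rw [minimalPeriod_apply_iterate (minimalPeriod_pos_iff_mem_periodicPts.mp (by omega)), hv]) (by
      intro i hi j hj hij
      exact iterate_injOn_Iio_minimalPeriod (by simpa using hi) (by simpa using hj) hij)
  rw [card_range, hv] at h
  exact h

lemma iter_periodic {n : ℕ} (f : Fin n → Fin n) (v : Fin n) {m : ℕ} (hm : n ≤ m) :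
    f^[m] v ∈ periodicPts f := by
  obtain ⟨i, hi, j, hj, hne, hij⟩ := Finset.exists_ne_map_eq_of_card_lt_of_maps_to
    (s := range (n + 1)) (t := (univ : Finset (Fin n))) (by simp) (f := fun i => f^[i] v) (fun _ _ => by simp)
  wlog hlt : i < j generalizing i j
  · exact this j hj i hi hne.symm hij.symm (by omega)
  simp only [mem_range] at hi hj
  have h1 : f^[i] v ∈ periodicPts f := by
    refine ⟨j - i, by omega, ?_⟩
    show f^[j - i] (f^[i] v) = f^[i] v
    rw [← iterate_add_apply, show j - i + i = j by omega]
    exact hij.symm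
  obtain ⟨t, ht, hp⟩ := h1
  refine ⟨t, ht, ?_⟩
  rw [show m = (m - i) + i by omega, iterate_add_apply]
  exact hp.apply_iterate _

lemma T_le {n : ℕ} {f : Fin n → Fin n} {L : ℕ} (hL : 0 < L)
    (h : ∀ v, 0 < minimalPeriod f v → minimalPeriod f v ∣ L) : T f ≤ L := by
  apply Nat.sInf_le
  refine ⟨hL, fun m hm => ?_⟩
  ext1 v
  have h1 := iter_periodic f v hm
  have h2 := h _ (minimalPeriod_pos_iff_mem_periodicPts.mpr h1)
  have h3 : IsPeriodicPt f L (f^[m] v) := isPeriodicPt_iff_minimalPeriod_dvd.mpr h2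
  rw [add_comm, iterate_add_apply]
  exact h3

lemma T_mem {n : ℕ} (f : Fin n → Fin n) : 0 < T f ∧ ∀ m, n ≤ m → f^[m + T f] = f^[m] := by
  apply Nat.sInf_mem (s := {T : ℕ | 0 < T ∧ ∀ m, n ≤ m → f^[m + T] = f^[m]})
  refine ⟨n.factorial, n.factorial_pos, fun m hm => ?_⟩
  ext1 v
  have h1 := iter_periodic f v hm
  have h2 : minimalPeriod f (f^[m] v) ∣ n.factorial :=
    Nat.dvd_factorial (minimalPeriod_pos_iff_mem_periodicPts.mpr h1) (minPer_le _ _)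
  have h3 : IsPeriodicPt f n.factorial (f^[m] v) := isPeriodicPt_iff_minimalPeriod_dvd.mpr h2
  rw [add_comm, iterate_add_apply]
  exact h3

lemma dvd_T {n : ℕ} (f : Fin n → Fin n) {v : Fin n} (hv : 0 < minimalPeriod f v) :
    minimalPeriod f v ∣ T f := by
  obtain ⟨h0, h⟩ := T_mem f
  have h1 := congrFun (h (n * minimalPeriod f v) (Nat.le_mul_of_pos_right _ hv)) v
  have h2 : f^[n * minimalPeriod f v] v = v := (isPeriodicPt_minimalPeriod f v).const_mul n
  rw [add_comm, iterate_add_apply, h2] at h1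
  exact isPeriodicPt_iff_minimalPeriod_dvd.mp h1

/-- index set for the upper bound -/
noncomputable def iset (y n : ℕ) : Finset ℕ :=
  (Ioc y (y ^ 2)).filter Nat.Prime ∪ Ioc (y ^ 2) n

noncomputable def kset (y i : ℕ) : Finset ℕ :=
  if i ≤ y ^ 2 then (Icc 1 (y ^ 2)).filter (fun k => i ∣ k) else {i}

lemma T_le_prod {n y : ℕ} (hn : 0 < n) (f : Fin n → Fin n) :
    (T f : ℝ) ≤ (n : ℝ) ^ y * ∏ i ∈ iset y n, (1 + ∑ k ∈ kset y i, ((i : ℝ) / k) * ak f k) := by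
  set q : ℕ → ℕ := fun i => if ∃ v, minimalPeriod f v ∈ kset y i then i else 1 with hq
  set D1 := ∏ p ∈ (Icc 1 y).filter Nat.Prime, p ^ (Nat.log p n) with hD1
  set D2 := ∏ i ∈ iset y n, q i with hD2
  have hqpos : ∀ i ∈ iset y n, 0 < q i := by
    intro i hi
    simp only [iset, mem_union, mem_filter, mem_Ioc] at hi
    simp only [hq]
    split_ifs <;> omega
  have hD2pos : 0 < D2 := prod_pos hqpos
  have hD1pos : 0 < D1 := prod_pos (by
    intro p hp
    simp only [mem_filter] at hp
    exact pow_pos hp.2.pos _)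
  have hT : T f ≤ D1 * D2 := by
    apply T_le (by positivity)
    intro v hv
    have hvn := minPer_le f v
    set k := minimalPeriod f v with hk
    by_cases hkY : k ≤ y ^ 2
    · rw [Nat.dvd_iff_prime_pow_dvd_dvd]
      intro p j hp hpj
      rcases Nat.eq_zero_or_pos j with rfl | hj
      · simp
      have hple : p ^ j ≤ k := Nat.le_of_dvd hv hpj
      have hpk : p ∣ k := (dvd_pow_self p hj.ne').trans hpj
      by_cases hpy : p ≤ y
      · have h1 : p ^ j ∣ p ^ Nat.log p n := by
          apply pow_dvd_pow
          exact Nat.le_log_of_pow_le hp.one_lt (by omega)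
        refine (h1.trans ?_).trans (Dvd.intro _ rfl)
        apply dvd_prod_of_mem (fun p => p ^ Nat.log p n)
        simp only [mem_filter, mem_Icc]
        exact ⟨⟨hp.one_lt.le, hpy⟩, hp⟩
      · push Not at hpy
        have hj1 : j = 1 := by
          by_contra hne
          have : p ^ 2 ≤ p ^ j := Nat.pow_le_pow_right hp.pos (by omega)
          have : y ^ 2 < p ^ 2 := Nat.pow_lt_pow_left hpy (by norm_num)
          omega
        rw [hj1, pow_one] at hple ⊢
        have hmem : p ∈ iset y n := by
          simp only [iset, mem_union, mem_filter, mem_Ioc]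
          exact Or.inl ⟨⟨hpy, by omega⟩, hp⟩
        have hqp : q p = p := by
          simp only [hq]
          rw [if_pos]
          refine ⟨v, ?_⟩
          rw [kset, if_pos (by omega), mem_filter, mem_Icc]
          exact ⟨⟨hv, hkY⟩, hpk⟩
        have := dvd_prod_of_mem q hmem
        rw [hqp] at this
        exact this.trans (Dvd.intro_left _ rfl)
    · push Not at hkY
      have hmem : k ∈ iset y n := by
        simp only [iset, mem_union, mem_filter, mem_Ioc]
        exact Or.inr ⟨hkY, hvn⟩
      have hqp : q k = k := by
        simp only [hq]
        rw [if_pos]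
        refine ⟨v, ?_⟩
        rw [kset, if_neg (by omega)]
        simp [hk]
      have := dvd_prod_of_mem q hmem
      rw [hqp] at this
      exact this.trans (Dvd.intro_left _ rfl)
  have hD1le : D1 ≤ n ^ y := by
    calc D1 ≤ ∏ p ∈ (Icc 1 y).filter Nat.Prime, n := by
          apply prod_le_prod' 
          intro p hp
          exact Nat.pow_log_le_self p (by omega)
      _ = n ^ ((Icc 1 y).filter Nat.Prime).card := by rw [prod_const]
      _ ≤ n ^ y := by
          apply Nat.pow_le_pow_right hn
          refine (card_filter_le _ _).trans ?_
          simp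
  have hqle : ∀ i ∈ iset y n, (q i : ℝ) ≤ 1 + ∑ k ∈ kset y i, ((i : ℝ) / k) * ak f k := by
    intro i hi
    have hnn : ∀ k ∈ kset y i, 0 ≤ ((i : ℝ) / k) * ak f k := fun k _ => by positivity
    by_cases h : ∃ v, minimalPeriod f v ∈ kset y i
    · simp only [hq, if_pos h]
      obtain ⟨v, hv⟩ := h
      have hpos : 0 < minimalPeriod f v := by
        simp only [kset] at hv
        split_ifs at hv with h
        · simp only [mem_filter, mem_Icc] at hv; omega
        · simp only [mem_singleton] at hv; omega
      have h1 := single_le_sum hnn hv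
      have h2 := ak_ge hpos rfl
      have h3 : (i : ℝ) ≤ ((i : ℝ) / (minimalPeriod f v)) * ak f (minimalPeriod f v) := by
        rw [div_mul_eq_mul_div, le_div_iff₀ (by exact_mod_cast hpos)]
        gcongr
      linarith
    · simp only [hq, if_neg h]
      have := sum_nonneg hnn
      push_cast
      linarith
  calc (T f : ℝ) ≤ (D1 : ℝ) * D2 := by exact_mod_cast hT
    _ ≤ (n : ℝ) ^ y * ∏ i ∈ iset y n, (1 + ∑ k ∈ kset y i, ((i : ℝ) / k) * ak f k) := by
        gcongr
        · exact_mod_cast hD1le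
        · rw [hD2]; push_cast
          exact prod_le_prod (fun i _ => by positivity) hqle

lemma kset_pos {y n i k : ℕ} (hi : i ∈ iset y n) (hk : k ∈ kset y i) : 0 < k := by
  simp only [kset, iset, mem_union, mem_filter, mem_Ioc] at hk hi
  split_ifs at hk with h
  · simp only [mem_filter, mem_Icc] at hk; omega
  · simp only [mem_singleton] at hk; omega

lemma kset_disj {y n : ℕ} : (iset y n : Set ℕ).PairwiseDisjoint (kset y) := by
  intro i hi j hj hij
  rw [Function.onFun, Finset.disjoint_left]
  intro k hki hkj
  simp only [kset] at hki hkj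
  simp only [iset, coe_union, coe_filter, Set.mem_union, mem_Ioc, coe_Ioc, Set.mem_Ioc, Set.mem_ofPred_eq] at hi hj
  split_ifs at hki hkj with h1 h2 h2
  · simp only [mem_filter, mem_Icc] at hki hkj
    have hip : i.Prime := by rcases hi with h | h; exact h.2; omega
    have hjp : j.Prime := by rcases hj with h | h; exact h.2; omega
    have := ((Nat.coprime_primes hip hjp).mpr hij).mul_dvd_of_dvd_of_dvd hki.2 hkj.2
    have := Nat.le_of_dvd (by omega) this
    have : y < i := by omega
    have : y < j := by omega
    nlinarith
  · simp only [mem_filter, mem_Icc, mem_singleton] at hki hkj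
    omega
  · simp only [mem_filter, mem_Icc, mem_singleton] at hki hkj
    omega
  · simp only [mem_singleton] at hki hkj
    omega
end Comb

section Comb
open Finset

abbrev XK (K : Finset ℕ) := Σ k : {x // x ∈ K}, Fin k.1

def nx {K : Finset ℕ} (x : XK K) : XK K :=
  ⟨x.1, ⟨(x.2.1 + 1) % x.1.1, Nat.mod_lt _ (lt_of_le_of_lt (Nat.zero_le _) x.2.2)⟩⟩

lemma card_XK (K : Finset ℕ) : Fintype.card (XK K) = ∑ k ∈ K, k := by
  rw [Fintype.card_sigma]
  simp only [Fintype.card_fin]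
  exact Finset.sum_coe_sort K (fun k => k)

noncomputable def cons {n : ℕ} {K : Finset ℕ} (e : XK K → Fin n) : Finset (Fin n → Fin n) :=
  univ.filter (fun f => ∀ x, f (e x) = e (nx x))

noncomputable def injs (n : ℕ) (K : Finset ℕ) : Finset (XK K → Fin n) := univ.filter Injective

lemma card_injs (n : ℕ) (K : Finset ℕ) : (injs n K).card = n.descFactorial (∑ k ∈ K, k) := by
  have h := Fintype.card_embedding_eq (α := XK K) (β := Fin n)
  rw [Fintype.card_fin, card_XK] at h
  rw [← h, ← Fintype.card_congr (Equiv.subtypeInjectiveEquivEmbedding (XK K) (Fin n)),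
    Fintype.card_subtype]
  rfl

lemma card_range_compl {n : ℕ} {K : Finset ℕ} {e : XK K → Fin n} (he : Injective e) :
    (univ.filter (fun v => ¬ ∃ x, e x = v)).card = n - ∑ k ∈ K, k := by
  have h1 : (univ.filter (fun v => ∃ x, e x = v)).card = ∑ k ∈ K, k := by
    rw [← card_XK, ← Finset.card_univ, ← Finset.card_image_of_injective univ he]
    congr 1
    ext v
    simp
  have h2 := Finset.card_filter_add_card_filter_not (s := (univ : Finset (Fin n))) (fun v => ∃ x, e x = v)
  rw [h1, Finset.card_univ, Fintype.card_fin] at h2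
  omega

lemma card_cons_le {n : ℕ} {K : Finset ℕ} {e : XK K → Fin n} (he : Injective e) :
    (cons e).card ≤ n ^ (n - ∑ k ∈ K, k) := by
  set t : Fin n → Finset (Fin n) := fun v => if h : ∃ x, e x = v then {e (nx h.choose)} else univ with ht
  have hsub : cons e ⊆ Fintype.piFinset t := by
    intro f hf
    simp only [cons, mem_filter, mem_univ, true_and] at hf
    rw [Fintype.mem_piFinset]
    intro v
    simp only [ht]
    split_ifs with h
    · rw [mem_singleton, ← hf, h.choose_spec]
    · simp
  refine (card_le_card hsub).trans ?_
  rw [Fintype.card_piFinset]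
  have : ∀ v, (t v).card = if ¬ ∃ x, e x = v then n else 1 := by
    intro v
    simp only [ht]
    split_ifs <;> simp
  simp_rw [this]
  rw [← prod_filter, prod_const, card_range_compl he]

/-- upper bound on moments -/
lemma moment_le (n : ℕ) (K : Finset ℕ) (hK : ∀ k ∈ K, 0 < k) :
    ∑ f : Fin n → Fin n, ∏ k ∈ K, ak f k ≤ n.descFactorial (∑ k ∈ K, k) * n ^ (n - ∑ k ∈ K, k) := by
  have h1 : ∑ f : Fin n → Fin n, ∏ k ∈ K, ak f k =
     ((univ : Finset (Fin n → Fin n)).sigma (fun f => Fintype.piFinset (fun k : {x // x ∈ K} => univ.filter (fun v => minimalPeriod f v = k.1)))).card := by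
    rw [card_sigma]
    refine sum_congr rfl fun f _ => ?_
    rw [Fintype.card_piFinset]
    exact (prod_coe_sort K (fun k => ak f k)).symm
  have h2 : ((injs n K).sigma (fun e => cons e)).card ≤ n.descFactorial (∑ k ∈ K, k) * n ^ (n - ∑ k ∈ K, k) := by
    rw [card_sigma]
    calc ∑ e ∈ injs n K, (cons e).card ≤ ∑ e ∈ injs n K, n ^ (n - ∑ k ∈ K, k) := by
          apply sum_le_sum
          intro e he
          simp only [injs, mem_filter] at he
          exact card_cons_le he.2
      _ = _ := by rw [sum_const, card_injs, smul_eq_mul]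
  rw [h1]
  refine le_trans ?_ h2
  apply card_le_card_of_injOn (fun p => ⟨fun x => p.1^[x.2.1] (p.2 x.1), p.1⟩)
  · rintro ⟨f, v⟩ h
    simp only [coe_sigma, Set.mem_sigma_iff, mem_coe, mem_univ, true_and, Fintype.mem_piFinset, mem_filter] at h
    simp only [coe_sigma, Set.mem_sigma_iff, mem_coe, injs, cons, mem_filter, mem_univ, true_and]
    have hper : ∀ k, v k ∈ periodicPts f := fun k =>
      minimalPeriod_pos_iff_mem_periodicPts.mp (by rw [h k]; exact hK _ k.2)
    constructor
    · rintro ⟨k, i⟩ ⟨l, j⟩ hij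
      simp only at hij
      have e1 : minimalPeriod f (f^[i.1] (v k)) = k.1 := by rw [minimalPeriod_apply_iterate (hper k), h k]
      have e2 : minimalPeriod f (f^[j.1] (v l)) = l.1 := by rw [minimalPeriod_apply_iterate (hper l), h l]
      have hkl : k = l := by
        apply Subtype.ext
        rw [← e1, ← e2, hij]
      subst hkl
      have : i.1 = j.1 := by
        apply iterate_injOn_Iio_minimalPeriod (f := f) (x := v k)
        · rw [Set.mem_Iio, h k]; exact i.2
        · rw [Set.mem_Iio, h k]; exact j.2
        · exact hij
      rw [Fin.ext this]
    · rintro ⟨k, i⟩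
      simp only [nx]
      rw [← iterate_succ_apply' f]
      have := iterate_mod_minimalPeriod_eq (f := f) (x := v k) (n := i.1 + 1)
      rw [h k] at this
      exact this.symm
  · rintro ⟨f, v⟩ h ⟨f', v'⟩ h' he
    simp only [Sigma.mk.injEq, heq_eq_eq] at he
    obtain ⟨h1, h2⟩ := he
    subst h2
    congr 1
    funext k
    have := congrFun h1 ⟨k, ⟨0, hK _ k.2⟩⟩
    simpa using this

noncomputable def hh (n s : ℕ) : ℝ := (n.descFactorial s : ℝ) / (n : ℝ) ^ s

lemma moment_le' {n : ℕ} (hn : 0 < n) (K : Finset ℕ) (hK : ∀ k ∈ K, 0 < k) :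
    ∑ f : Fin n → Fin n, ∏ k ∈ K, (ak f k : ℝ) ≤ (n : ℝ) ^ n * hh n (∑ k ∈ K, k) := by
  have h := moment_le n K hK
  set s := ∑ k ∈ K, k
  have h' : ∑ f : Fin n → Fin n, ∏ k ∈ K, (ak f k : ℝ) ≤ (n.descFactorial s : ℝ) * (n : ℝ) ^ (n - s) := by
    exact_mod_cast h
  refine h'.trans ?_
  unfold hh
  rcases le_or_gt s n with hs | hs
  · have : (n : ℝ) ^ n = (n : ℝ) ^ (n - s) * (n : ℝ) ^ s := by rw [← pow_add]; congr 1; omega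
    rw [this]
    have hn' : (n : ℝ) ^ s ≠ 0 := by positivity
    apply le_of_eq
    field_simp
  · rw [Nat.descFactorial_of_lt hs]; simp

lemma hh_zero (n : ℕ) : hh n 0 = 1 := by simp [hh]

lemma hh_succ {n : ℕ} (hn : 0 < n) {s : ℕ} (hs : s ≤ n) : hh n (s + 1) = (1 - (s : ℝ) / n) * hh n s := by
  unfold hh
  rw [Nat.descFactorial_succ, pow_succ]
  have hn' : (n : ℝ) ≠ 0 := by positivity
  push_cast [Nat.cast_sub hs]
  field_simp

lemma hh_nonneg (n s : ℕ) : 0 ≤ hh n s := by unfold hh; positivity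

lemma hh_le {n : ℕ} (hn : 0 < n) {s : ℕ} (hs : s ≤ n) :
    hh n s ≤ Real.exp (-((s : ℝ) * (s - 1) / (2 * n))) := by
  induction s with
  | zero => simp [hh_zero]
  | succ s ih =>
    rw [hh_succ hn (by omega)]
    have h1 : 1 - (s : ℝ) / n ≤ Real.exp (-((s : ℝ) / n)) := by
      have := Real.add_one_le_exp (-((s : ℝ) / n))
      linarith
    have h2 : 0 ≤ 1 - (s : ℝ) / n := by
      rw [sub_nonneg, div_le_one (by positivity)]
      exact_mod_cast (by omega : s ≤ n)
    calc _ ≤ Real.exp (-((s : ℝ) / n)) * Real.exp (-((s : ℝ) * (s - 1) / (2 * n))) := by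
          gcongr
          · exact hh_nonneg _ _
          · exact ih (by omega)
      _ = _ := by
          rw [← Real.exp_add]
          congr 1
          push_cast
          have hn' : (n : ℝ) ≠ 0 := by positivity
          field_simp
          ring

lemma hh_le_C {n : ℕ} (hn : 0 < n) {N : ℝ} (hN : 0 < N) (s : ℕ) :
    hh n s ≤ Real.exp (1 / 2 + n / (2 * N ^ 2)) * (Real.exp (-1 / N)) ^ s := by
  rcases le_or_gt s n with hs | hs
  · refine (hh_le hn hs).trans ?_
    rw [← Real.exp_nat_mul, ← Real.exp_add, Real.exp_le_exp]
    have hn' : (0:ℝ) < n := by positivity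
    have h1 : (s : ℝ) / (2 * n) ≤ 1 / 2 := by
      rw [div_le_div_iff₀ (by positivity) (by norm_num)]
      have : (s : ℝ) ≤ n := by exact_mod_cast hs
      linarith
    have h2 : 0 ≤ ((s : ℝ) - n / N) ^ 2 / (2 * n) := by positivity
    have h3 : ((s : ℝ) - n / N) ^ 2 / (2 * n) = (s : ℝ) ^ 2 / (2 * n) - s / N + n / (2 * N ^ 2) := by
      field_simp; ring
    have h4 : -((s : ℝ) * (s - 1) / (2 * n)) = -((s : ℝ) ^ 2 / (2 * n)) + s / (2 * n) := by ring
    have h5 : (s : ℝ) * (-1 / N) = - (s / N) := by ring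
    rw [h4, h5]
    linarith
  · have : hh n s = 0 := by unfold hh; rw [Nat.descFactorial_of_lt hs]; simp
    rw [this]; positivity

lemma hh_ge {n : ℕ} (hn : 0 < n) {s : ℕ} (hs : 2 * s ≤ n) :
    Real.exp (-((s : ℝ) ^ 2 / (2 * n) + (s : ℝ) ^ 3 / n ^ 2)) ≤ hh n s := by
  have hn' : (0:ℝ) < n := by positivity
  have key : ∀ t : ℝ, 0 ≤ t → t ≤ 1 / 2 → Real.exp (-(t + t ^ 2)) ≤ 1 - t := by
    intro t h0 h1
    rw [Real.exp_neg, inv_le_comm₀ (Real.exp_pos _) (by linarith)]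
    have := Real.quadratic_le_exp_of_nonneg (x := t + t ^ 2) (by positivity)
    refine le_trans ?_ this
    rw [inv_le_iff_one_le_mul₀ (by linarith)]
    have e : (1 + (t + t ^ 2) + (t + t ^ 2) ^ 2 / 2) * (1 - t) = 1 + t ^ 2 / 2 * (1 - t - t ^ 2 - t ^ 3) := by ring
    rw [e]
    have h2 : t ^ 2 ≤ 1 / 4 := by nlinarith
    have h3 : t ^ 3 ≤ 1 / 8 := by nlinarith
    have : 0 ≤ t ^ 2 / 2 * (1 - t - t ^ 2 - t ^ 3) := mul_nonneg (by positivity) (by linarith)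
    linarith
  induction s with
  | zero => simp [hh_zero]
  | succ s ih =>
    rw [hh_succ hn (by omega)]
    have hs2 : (s : ℝ) / n ≤ 1 / 2 := by
      rw [div_le_div_iff₀ hn' (by norm_num)]
      have : ((2 * (s + 1) : ℕ) : ℝ) ≤ n := by exact_mod_cast hs
      push_cast at this
      linarith
    have h1 := key ((s : ℝ) / n) (by positivity) hs2
    calc _ ≤ Real.exp (-((s : ℝ) / n + ((s : ℝ) / n) ^ 2)) * Real.exp (-((s : ℝ) ^ 2 / (2 * n) + (s : ℝ) ^ 3 / n ^ 2)) := by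
          rw [← Real.exp_add, Real.exp_le_exp]
          have e : (((s + 1 : ℕ) : ℝ) ^ 2 / (2 * n) + ((s + 1 : ℕ) : ℝ) ^ 3 / n ^ 2) - ((s : ℝ) / n + ((s : ℝ) / n) ^ 2 + ((s : ℝ) ^ 2 / (2 * n) + (s : ℝ) ^ 3 / n ^ 2))
             = 1 / (2 * n) + (2 * (s:ℝ) ^ 2 + 3 * s + 1) / n ^ 2 := by
            push_cast; field_simp; ring
          have : 0 ≤ 1 / (2 * (n:ℝ)) + (2 * (s:ℝ) ^ 2 + 3 * s + 1) / (n:ℝ) ^ 2 := by positivity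
          linarith
      _ ≤ _ := by
          have : 0 ≤ 1 - (s : ℝ) / n := by linarith
          gcongr
          exact ih (by omega)

/-- expectation of product -/
lemma exp_prod_le {n : ℕ} (hn : 0 < n) {N : ℝ} (hN : 0 < N) (S : ℕ → Finset ℕ) (al : ℕ → ℕ → ℝ)
    (hal : ∀ i k, 0 ≤ al i k) (J : Finset ℕ) :
    (∀ i ∈ J, ∀ k ∈ S i, 0 < k) → ((J : Set ℕ).PairwiseDisjoint S) →
    ∀ K : Finset ℕ, (∀ k ∈ K, 0 < k) → (∀ i ∈ J, Disjoint K (S i)) →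
    ∑ f : Fin n → Fin n, (∏ k ∈ K, (ak f k : ℝ)) * ∏ i ∈ J, (1 + ∑ k ∈ S i, al i k * ak f k) ≤
      (n : ℝ) ^ n * Real.exp (1 / 2 + n / (2 * N ^ 2)) * (∏ k ∈ K, Real.exp (-1 / N) ^ k) *
        ∏ i ∈ J, (1 + ∑ k ∈ S i, al i k * Real.exp (-1 / N) ^ k) := by
  induction J using Finset.induction_on with
  | empty =>
    intro _ _ K hK _
    simp only [prod_empty, mul_one]
    refine (moment_le' hn K hK).trans ?_
    rw [mul_assoc, prod_pow_eq_pow_sum]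
    gcongr
    exact hh_le_C hn hN _
  | insert a J ha ih =>
    intro hpos hdisj K hK hKd
    have ih' := ih (fun i hi => hpos i (mem_insert_of_mem hi))
      (hdisj.subset (by intro x hx; simp at hx ⊢; exact Or.inr hx))
    set x := Real.exp (-1 / N) with hx
    have hKa : Disjoint K (S a) := hKd a (mem_insert_self _ _)
    simp_rw [prod_insert ha]
    have e1 : ∀ f : Fin n → Fin n, (∏ k ∈ K, (ak f k : ℝ)) * ((1 + ∑ k ∈ S a, al a k * ak f k) * ∏ i ∈ J, (1 + ∑ k ∈ S i, al i k * ak f k))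
       = (∏ k ∈ K, (ak f k : ℝ)) * (∏ i ∈ J, (1 + ∑ k ∈ S i, al i k * ak f k)) +
         ∑ m ∈ S a, al a m * ((∏ k ∈ insert m K, (ak f k : ℝ)) * (∏ i ∈ J, (1 + ∑ k ∈ S i, al i k * ak f k))) := by
      intro f
      rw [add_mul, mul_add, one_mul, sum_mul, mul_sum]
      congr 1
      refine sum_congr rfl fun m hm => ?_
      rw [prod_insert (fun h => Finset.disjoint_left.mp hKa h hm)]
      ring
    simp_rw [e1]
    rw [sum_add_distrib, sum_comm]
    simp_rw [← mul_sum]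
    have b1 := ih' K hK (fun i hi => hKd i (mem_insert_of_mem hi))
    have b2 : ∀ m ∈ S a, _ := fun m hm => ih' (insert m K) (by
        intro k hk
        rcases mem_insert.mp hk with rfl | hk
        · exact hpos a (mem_insert_self _ _) _ hm
        · exact hK k hk) (by
        intro i hi
        rw [disjoint_insert_left]
        refine ⟨fun h => ?_, hKd i (mem_insert_of_mem hi)⟩
        have := hdisj (by simp) (by simp [hi]) (fun h : a = i => ha (h ▸ hi))
        exact Finset.disjoint_left.mp this hm h)
    calc _ ≤ (n : ℝ) ^ n * Real.exp (1 / 2 + n / (2 * N ^ 2)) * (∏ k ∈ K, x ^ k) * (∏ i ∈ J, (1 + ∑ k ∈ S i, al i k * x ^ k))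
          + ∑ m ∈ S a, al a m * ((n : ℝ) ^ n * Real.exp (1 / 2 + n / (2 * N ^ 2)) * (∏ k ∈ insert m K, x ^ k) * (∏ i ∈ J, (1 + ∑ k ∈ S i, al i k * x ^ k))) := by
          apply add_le_add b1
          apply sum_le_sum
          intro m hm
          exact mul_le_mul_of_nonneg_left (b2 m hm) (hal a m)
      _ = _ := by
          rw [add_mul, mul_add, one_mul, sum_mul, mul_sum]
          congr 1
          refine sum_congr rfl fun m hm => ?_
          rw [prod_insert (fun h => Finset.disjoint_left.mp hKa h hm)]
          ring

lemma E_le {n y : ℕ} (hn : 0 < n) {N : ℝ} (hN : 0 < N) :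
    (∑ f : Fin n → Fin n, (T f : ℝ)) / (n : ℝ) ^ n ≤ (n : ℝ) ^ y * Real.exp (1 / 2 + n / (2 * N ^ 2)) *
      ∏ i ∈ iset y n, (1 + ∑ k ∈ kset y i, ((i : ℝ) / k) * Real.exp (-1 / N) ^ k) := by
  have h := exp_prod_le hn hN (kset y) (fun i k => (i : ℝ) / k) (fun i k => by positivity) (iset y n)
    (fun i hi k hk => kset_pos hi hk) kset_disj ∅ (by simp) (by simp)
  simp only [prod_empty, one_mul, mul_one] at h
  have hnn : (0:ℝ) < (n : ℝ) ^ n := by positivity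
  rw [div_le_iff₀ hnn]
  calc _ ≤ ∑ f : Fin n → Fin n, (n : ℝ) ^ y * ∏ i ∈ iset y n, (1 + ∑ k ∈ kset y i, ((i : ℝ) / k) * ak f k) :=
        sum_le_sum fun f _ => T_le_prod hn f
    _ = (n : ℝ) ^ y * ∑ f : Fin n → Fin n, ∏ i ∈ iset y n, (1 + ∑ k ∈ kset y i, ((i : ℝ) / k) * ak f k) := by
        rw [mul_sum]
    _ ≤ _ := by
        refine (mul_le_mul_of_nonneg_left h (by positivity)).trans (le_of_eq ?_)
        ring
end Comb

section Comb
open Finset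

def Reach {n : ℕ} (S : Finset (Fin n)) (f : Fin n → Fin n) : Prop := ∀ v, ∃ i, f^[i] v ∈ S

noncomputable def AS {n : ℕ} (S : Finset (Fin n)) : Finset (Fin n → Fin n) :=
  univ.filter (fun f => (∀ v ∈ S, f v = v) ∧ Reach S f)

noncomputable def fl {n : ℕ} (S : Finset (Fin n)) (q : Fin n) : Finset ((Fin n → Fin n) × Fin n) :=
  univ.filter (fun p => p.1 ∈ AS S ∧ ∃ i, p.1^[i] p.2 = q)

lemma sum_fl {n : ℕ} (S : Finset (Fin n)) : (AS S).card * n = ∑ q ∈ S, (fl S q).card := by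
  have h1 : ((AS S) ×ˢ (univ : Finset (Fin n))).card = (AS S).card * n := by simp
  rw [← h1]
  rw [← card_biUnion]
  · congr 1
    ext ⟨f, v⟩
    simp only [mem_product, mem_univ, and_true, mem_biUnion, fl, mem_filter, true_and]
    constructor
    · intro h
      have h' := h
      simp only [AS, mem_filter] at h'
      obtain ⟨i, hi⟩ := h'.2.2 v
      exact ⟨_, hi, h, i, rfl⟩
    · rintro ⟨q, hq, h, _⟩
      exact h
  · intro q hq q' hq' hne
    rw [Function.onFun, Finset.disjoint_left]
    rintro ⟨f, v⟩ h h'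
    simp only [fl, mem_filter, mem_univ, true_and, AS] at h h'
    obtain ⟨⟨hf, _⟩, i, hi⟩ := h
    obtain ⟨_, j, hj⟩ := h'
    apply hne
    have e1 : f^[i + j] v = q := by
      rw [add_comm, iterate_add_apply, hi]; exact iterate_fixed (hf q hq) j
    have e2 : f^[i + j] v = q' := by
      rw [iterate_add_apply, hj]; exact iterate_fixed (hf q' hq') i
    rw [← e1, ← e2]

lemma fl_le {n : ℕ} {S : Finset (Fin n)} {q q' : Fin n} (hq : q ∈ S) (hq' : q' ∈ S) :
    (fl S q).card ≤ (fl S q').card := by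
  set t := Equiv.swap q q' with ht
  have tt : ∀ v, t (t v) = v := Equiv.swap_apply_self q q'
  have tS : ∀ v, v ∈ S → t v ∈ S := by
    intro v hv
    rw [ht, Equiv.swap_apply_def]
    split_ifs <;> assumption
  have it : ∀ (f : Fin n → Fin n) i v, (fun u => t (f (t u)))^[i] v = t (f^[i] (t v)) := by
    intro f i
    induction i with
    | zero => intro v; simp [tt]
    | succ i ih => intro v; rw [iterate_succ_apply, ih, tt, iterate_succ_apply]
  apply card_le_card_of_injOn (fun p => (fun u => t (p.1 (t u)), t p.2))
  · rintro ⟨f, v⟩ h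
    simp only [fl, AS, coe_filter, mem_filter, mem_univ, true_and, Set.mem_ofPred_eq] at h ⊢
    obtain ⟨⟨hf, hr⟩, i, hi⟩ := h
    refine ⟨⟨fun u hu => ?_, fun u => ?_⟩, i, ?_⟩
    · rw [hf _ (tS u hu), tt]
    · obtain ⟨j, hj⟩ := hr (t u)
      exact ⟨j, by rw [it]; exact tS _ hj⟩
    · rw [it, tt, hi, ht, Equiv.swap_apply_left]
  · rintro ⟨f, v⟩ h ⟨f', v'⟩ h' he
    simp only [Prod.mk.injEq, EmbeddingLike.apply_eq_iff_eq] at he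
    obtain ⟨h1, h2⟩ := he
    rw [Prod.mk.injEq]
    refine ⟨?_, h2⟩
    funext u
    have := congrFun h1 (t u)
    simp only [tt, EmbeddingLike.apply_eq_iff_eq] at this
    exact this

lemma AS_ge {n : ℕ} {S : Finset (Fin n)} {r : Fin n} (hr : r ∉ S) :
    ∑ q ∈ S, (fl (insert r S) q).card ≤ (AS S).card := by
  rw [← card_biUnion]
  · apply card_le_card_of_injOn (fun p => update p.1 r p.2)
    · rintro ⟨f, v⟩ h
      simp only [coe_biUnion, Set.mem_iUnion, fl, AS, coe_filter, mem_coe, mem_filter, mem_univ, true_and, Set.mem_ofPred_eq] at h ⊢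
      obtain ⟨q, hq, ⟨hf, hre⟩, i, hi⟩ := h
      have hfr : f r = r := hf r (mem_insert_self _ _)
      have hqr : q ≠ r := fun h => hr (h ▸ hq)
      set g := update f r v with hg
      have hg1 : ∀ u, u ≠ r → g u = f u := fun u hu => update_of_ne hu _ _
      have hgr : g r = v := update_self _ _ _
      -- v reaches q under g
      have hv : ∀ j ≤ i, g^[j] v = f^[j] v := by
        intro j
        induction j with
        | zero => simp
        | succ j ih =>
          intro hj
          rw [iterate_succ_apply', iterate_succ_apply', ih (by omega)]
          apply hg1
          intro hc
          apply hqr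
          rw [← hi, show i = (i - j) + j by omega, iterate_add_apply, hc]
          exact iterate_fixed hfr _
      have hvS : ∃ j, g^[j] v ∈ S := ⟨i, by rw [hv i le_rfl, hi]; exact hq⟩
      have hcase : ∀ u j, f^[j] u = g^[j] u ∨ ∃ m, g^[m] u = r := by
        intro u j
        induction j with
        | zero => left; rfl
        | succ j ih =>
          rcases ih with h | h
          · by_cases hc : g^[j] u = r
            · exact Or.inr ⟨j, hc⟩
            · left
              rw [iterate_succ_apply', iterate_succ_apply', h, hg1 _ hc]
          · exact Or.inr h
      have hrr : ∀ u, (∃ m, g^[m] u = r) → ∃ j, g^[j] u ∈ S := by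
        rintro u ⟨m, hm⟩
        obtain ⟨j, hj⟩ := hvS
        refine ⟨j + 1 + m, ?_⟩
        rw [iterate_add_apply, hm, iterate_succ_apply, hgr]
        exact hj
      refine ⟨fun u hu => ?_, fun u => ?_⟩
      · rw [hg1 u (fun h => hr (h ▸ hu))]; exact hf u (mem_insert_of_mem hu)
      · obtain ⟨j, hj⟩ := hre u
        rcases hcase u j with h | h
        · rw [h] at hj
          rcases mem_insert.mp hj with h' | h'
          · exact hrr u ⟨j, h'⟩
          · exact ⟨j, h'⟩
        · exact hrr u h
    · rintro ⟨f, v⟩ h ⟨f', v'⟩ h' he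
      simp only [coe_biUnion, Set.mem_iUnion, fl, AS, coe_filter, mem_coe, mem_filter, mem_univ, true_and, Set.mem_ofPred_eq] at h h'
      obtain ⟨q, hq, ⟨hf, hre⟩, i, hi⟩ := h
      obtain ⟨q', hq', ⟨hf', hre'⟩, i', hi'⟩ := h'
      simp only at he
      have hv : v = v' := by
        have := congrFun he r
        simpa using this
      rw [Prod.mk.injEq]
      refine ⟨?_, hv⟩
      funext u
      by_cases hu : u = r
      · rw [hu, hf r (mem_insert_self _ _), hf' r (mem_insert_self _ _)]
      · have := congrFun he u
        rwa [update_of_ne hu, update_of_ne hu] at this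
  · intro q hq q' hq' hne
    rw [Function.onFun, Finset.disjoint_left]
    rintro ⟨f, v⟩ h h'
    simp only [fl, mem_filter, mem_univ, true_and, AS] at h h'
    obtain ⟨⟨hf, _⟩, i, hi⟩ := h
    obtain ⟨_, j, hj⟩ := h'
    apply hne
    have e1 : f^[i + j] v = q := by
      rw [add_comm, iterate_add_apply, hi]; exact iterate_fixed (hf q (mem_insert_of_mem hq)) j
    have e2 : f^[i + j] v = q' := by
      rw [iterate_add_apply, hj]; exact iterate_fixed (hf q' (mem_insert_of_mem hq')) i
    rw [← e1, ← e2]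

lemma AS_step {n : ℕ} {S : Finset (Fin n)} {r : Fin n} (hr : r ∉ S) :
    S.card * (n * (AS (insert r S)).card) ≤ (S.card + 1) * (AS S).card := by
  set S' := insert r S with hS'
  have hrS : r ∈ S' := mem_insert_self _ _
  set ph := (fl S' r).card with hph
  have heq : ∀ q ∈ S', (fl S' q).card = ph := fun q hq => le_antisymm (fl_le hq hrS) (fl_le hrS hq)
  have h1 := sum_fl S'
  rw [sum_congr rfl heq, sum_const, smul_eq_mul, card_insert_of_notMem hr] at h1
  have h2 := AS_ge hr
  rw [sum_congr rfl (fun q hq => heq q (mem_insert_of_mem hq)), sum_const, smul_eq_mul] at h2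
  calc S.card * (n * (AS S').card) = (S.card + 1) * (S.card * ph) := by rw [mul_comm n, h1]; ring
    _ ≤ _ := Nat.mul_le_mul_left _ h2

lemma AS_card {n : ℕ} (d : ℕ) : ∀ S : Finset (Fin n), n = S.card + d →
    S.card * n ^ d ≤ (AS S).card * n := by
  induction d with
  | zero =>
    intro S hS
    have hu : S = univ := by
      rw [← Finset.card_eq_iff_eq_univ, Fintype.card_fin]; omega
    have : 1 ≤ (AS S).card := by
      rw [Nat.one_le_iff_ne_zero, card_ne_zero]
      refine ⟨id, ?_⟩
      simp only [AS, mem_filter, mem_univ, true_and, id]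
      exact ⟨fun _ _ => trivial, fun v => ⟨0, by rw [hu]; simp⟩⟩
    rw [pow_zero, mul_one]
    nlinarith
  | succ d ih =>
    intro S hS
    obtain ⟨r, hr⟩ : ∃ r, r ∉ S := by
      by_contra h
      push Not at h
      have : S = univ := by ext; simp [h]
      rw [this, Finset.card_univ, Fintype.card_fin] at hS
      omega
    have h1 := ih (insert r S) (by rw [card_insert_of_notMem hr]; omega)
    rw [card_insert_of_notMem hr] at h1
    have h2 := AS_step hr
    have : (S.card + 1) * (S.card * n ^ (d + 1)) ≤ (S.card + 1) * ((AS S).card * n) := by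
      calc (S.card + 1) * (S.card * n ^ (d + 1)) = S.card * n * ((S.card + 1) * n ^ d) := by ring
        _ ≤ S.card * n * ((AS (insert r S)).card * n) := Nat.mul_le_mul_left _ h1
        _ = S.card * (n * (AS (insert r S)).card) * n := by ring
        _ ≤ (S.card + 1) * (AS S).card * n := Nat.mul_le_mul_right _ h2
        _ = _ := by ring
    exact Nat.le_of_mul_le_mul_left this (by omega)

/-- functions prescribed on `S` by `h` and reaching `S` -/
lemma presc_card {n : ℕ} (S : Finset (Fin n)) (h : Fin n → Fin n) :
    (AS S).card ≤ (univ.filter (fun f : Fin n → Fin n => (∀ v ∈ S, f v = h v) ∧ Reach S f)).card := by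
  apply card_le_card_of_injOn (fun f v => if v ∈ S then h v else f v)
  · intro f hf
    simp only [AS, coe_filter, mem_univ, true_and, Set.mem_ofPred_eq] at hf ⊢
    refine ⟨fun v hv => by simp [hv], fun v => ?_⟩
    obtain ⟨i, hi⟩ := hf.2 v
    induction i generalizing v with
    | zero => exact ⟨0, hi⟩
    | succ i ih =>
      by_cases hv : v ∈ S
      · exact ⟨0, hv⟩
      · obtain ⟨j, hj⟩ := ih (f v) hi
        refine ⟨j + 1, ?_⟩
        rw [iterate_succ_apply]
        simp only [if_neg hv]
        exact hj
  · intro f hf f' hf' he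
    simp only [AS, coe_filter, mem_univ, true_and, Set.mem_ofPred_eq] at hf hf'
    funext v
    by_cases hv : v ∈ S
    · rw [hf.1 v hv, hf'.1 v hv]
    · have := congrFun he v
      simpa [hv] using this

noncomputable def perset {n : ℕ} (f : Fin n → Fin n) : Finset ℕ :=
  (univ.image (minimalPeriod f)).filter (fun k => 0 < k)

noncomputable def FK (n : ℕ) (K : Finset ℕ) : Finset (Fin n → Fin n) :=
  univ.filter (fun f => perset f = K ∧ ∀ k ∈ K, ak f k = k)

lemma iter_e {n : ℕ} {K : Finset ℕ} {e : XK K → Fin n} {f : Fin n → Fin n}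
    (hf : ∀ x, f (e x) = e (nx x)) (hK : ∀ k ∈ K, 0 < k) (k : {x // x ∈ K}) (j : ℕ) :
    f^[j] (e ⟨k, ⟨0, hK _ k.2⟩⟩) = e ⟨k, ⟨j % k.1, Nat.mod_lt _ (hK _ k.2)⟩⟩ := by
  induction j with
  | zero => simp
  | succ j ih =>
    rw [iterate_succ_apply', ih, hf]
    simp only [nx, Nat.mod_add_mod]

lemma FK_mem {n : ℕ} {K : Finset ℕ} {e : XK K → Fin n} {f : Fin n → Fin n} (he : Injective e)
    (hf : ∀ x, f (e x) = e (nx x)) (hK : ∀ k ∈ K, 0 < k) (hr : Reach (univ.image e) f) :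
    (∀ x : XK K, minimalPeriod f (e x) = x.1.1) ∧ f ∈ FK n K := by
  have hit := iter_e hf hK
  have h1 : ∀ k : {x // x ∈ K}, minimalPeriod f (e ⟨k, ⟨0, hK _ k.2⟩⟩) = k.1 := by
    intro k
    apply Nat.dvd_antisymm
    · rw [← isPeriodicPt_iff_minimalPeriod_dvd]
      show f^[k.1] _ = _
      rw [hit]; simp
    · have := isPeriodicPt_minimalPeriod f (e ⟨k, ⟨0, hK _ k.2⟩⟩)
      have h2 : f^[minimalPeriod f (e ⟨k, ⟨0, hK _ k.2⟩⟩)] (e ⟨k, ⟨0, hK _ k.2⟩⟩) = e ⟨k, ⟨0, hK _ k.2⟩⟩ := this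
      rw [hit] at h2
      have h3 := he h2
      simp only [Sigma.mk.injEq, heq_eq_eq, true_and, Fin.mk.injEq] at h3
      exact Nat.dvd_of_mod_eq_zero h3
  have h2 : ∀ x : XK K, minimalPeriod f (e x) = x.1.1 := by
    rintro ⟨k, i⟩
    have := hit k i.1
    have e1 : (⟨k, ⟨i.1 % k.1, Nat.mod_lt _ (hK _ k.2)⟩⟩ : XK K) = ⟨k, i⟩ := by
      congr 1
      apply Fin.ext
      exact Nat.mod_eq_of_lt i.2
    rw [e1] at this
    rw [← this, minimalPeriod_apply_iterate (minimalPeriod_pos_iff_mem_periodicPts.mp (by rw [h1]; exact hK _ k.2)), h1]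
  have h3 : ∀ v, 0 < minimalPeriod f v → ∃ x, e x = v := by
    intro v hv
    have hclosed : ∀ j (x : XK K), ∃ x', f^[j] (e x) = e x' := by
      intro j
      induction j with
      | zero => intro x; exact ⟨x, rfl⟩
      | succ j ih => intro x; rw [iterate_succ_apply, hf]; exact ih _
    obtain ⟨i, hi⟩ := hr v
    simp only [mem_image, mem_univ, true_and] at hi
    obtain ⟨x, hx⟩ := hi
    have hp : f^[minimalPeriod f v * (i + 1)] v = v := (isPeriodicPt_minimalPeriod f v).mul_const (i + 1)
    have hle : i ≤ minimalPeriod f v * (i + 1) := by nlinarith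
    obtain ⟨x', hx'⟩ := hclosed (minimalPeriod f v * (i + 1) - i) x
    refine ⟨x', ?_⟩
    rw [← hx', hx, ← iterate_add_apply, Nat.sub_add_cancel hle, hp]
  refine ⟨h2, ?_⟩
  simp only [FK, mem_filter, mem_univ, true_and]
  constructor
  · ext k
    simp only [perset, mem_filter, mem_image, mem_univ, true_and]
    constructor
    · rintro ⟨⟨v, rfl⟩, hk⟩
      obtain ⟨x, rfl⟩ := h3 v hk
      rw [h2]; exact x.1.2
    · intro hk
      exact ⟨⟨_, h1 ⟨k, hk⟩⟩, hK k hk⟩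
  · intro k hk
    unfold ak
    have : univ.filter (fun v => minimalPeriod f v = k) = univ.image (fun i : Fin k => e ⟨⟨k, hk⟩, i⟩) := by
      ext v
      simp only [mem_filter, mem_univ, true_and, mem_image]
      constructor
      · intro hv
        obtain ⟨x, rfl⟩ := h3 v (by rw [hv]; exact hK k hk)
        rw [h2] at hv
        obtain ⟨⟨k', hk'⟩, i⟩ := x
        simp only at hv
        subst hv
        exact ⟨i, rfl⟩
      · rintro ⟨i, rfl⟩
        rw [h2]
    rw [this, card_image_of_injective, card_univ, Fintype.card_fin]
    intro i j hij
    have := he hij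
    simpa using this

lemma FK_card {n : ℕ} {K : Finset ℕ} (hK : ∀ k ∈ K, 0 < k) (hs : ∑ k ∈ K, k ≤ n) :
    n.descFactorial (∑ k ∈ K, k) * ((∑ k ∈ K, k) * n ^ (n - ∑ k ∈ K, k)) ≤ (FK n K).card * (∏ k ∈ K, k) * n := by
  set s := ∑ k ∈ K, k with hsdef
  set R : (XK K → Fin n) → Finset (Fin n → Fin n) := fun e => (cons e).filter (fun f => Reach (univ.image e) f) with hR
  have h1 : ∀ e ∈ injs n K, s * n ^ (n - s) ≤ (R e).card * n := by
    intro e he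
    simp only [injs, mem_filter, mem_univ, true_and] at he
    have hc : (univ.image e).card = s := by rw [card_image_of_injective _ he, card_univ, card_XK]
    have hA := AS_card (n - s) (univ.image e) (by rw [hc]; omega)
    rw [hc] at hA
    refine hA.trans (Nat.mul_le_mul_right _ ?_)
    refine (presc_card (univ.image e) (fun v => if h : ∃ x, e x = v then e (nx h.choose) else v)).trans ?_
    apply card_le_card
    intro f hf
    simp only [mem_filter, mem_univ, true_and, hR, cons] at hf ⊢
    refine ⟨fun x => ?_, hf.2⟩
    rw [hf.1 (e x) (mem_image_of_mem _ (mem_univ _))]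
    have hx : ∃ x', e x' = e x := ⟨x, rfl⟩
    rw [dif_pos hx, he hx.choose_spec]
  have h2 : ((injs n K).sigma R).card ≤ (FK n K).card * (∏ k ∈ K, k) := by
    have h3 : ((FK n K).sigma (fun f => Fintype.piFinset (fun k : {x // x ∈ K} => univ.filter (fun v => minimalPeriod f v = k.1)))).card = (FK n K).card * (∏ k ∈ K, k) := by
      rw [card_sigma, ← smul_eq_mul, ← sum_const]
      refine sum_congr rfl fun f hf => ?_
      rw [Fintype.card_piFinset]
      simp only [FK, mem_filter] at hf
      rw [← prod_congr rfl hf.2.2]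
      exact (prod_coe_sort K (fun k => ak f k))
    rw [← h3]
    apply card_le_card_of_injOn (fun p => ⟨p.2, fun k => p.1 ⟨k, ⟨0, hK _ k.2⟩⟩⟩)
    · rintro ⟨e, f⟩ h
      simp only [coe_sigma, Set.mem_sigma_iff, mem_coe, hR, injs, cons, mem_filter, mem_univ, true_and] at h
      obtain ⟨a, b⟩ := FK_mem h.1 h.2.1 hK h.2.2
      simp only [coe_sigma, Set.mem_sigma_iff, mem_coe, Fintype.mem_piFinset, mem_filter, mem_univ, true_and]
      exact ⟨b, fun k => a _⟩
    · rintro ⟨e, f⟩ h ⟨e', f'⟩ h' heq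
      simp only [coe_sigma, Set.mem_sigma_iff, mem_coe, hR, injs, cons, mem_filter, mem_univ, true_and] at h h'
      simp only [Sigma.mk.injEq, heq_eq_eq] at heq
      obtain ⟨hff, hee⟩ := heq
      subst hff
      congr 1
      funext x
      obtain ⟨k, i⟩ := x
      have a1 := iter_e h.2.1 hK k i.1
      have a2 := iter_e h'.2.1 hK k i.1
      have e1 : (⟨k, ⟨i.1 % k.1, Nat.mod_lt _ (hK _ k.2)⟩⟩ : XK K) = ⟨k, i⟩ := by
        congr 1
        apply Fin.ext
        exact Nat.mod_eq_of_lt i.2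
      rw [e1] at a1 a2
      rw [← a1, ← a2]
      congr 1
      exact congrFun hee k
  calc _ = ∑ e ∈ injs n K, s * n ^ (n - s) := by rw [sum_const, card_injs, smul_eq_mul]
    _ ≤ ∑ e ∈ injs n K, (R e).card * n := sum_le_sum h1
    _ = ((injs n K).sigma R).card * n := by rw [card_sigma, sum_mul]
    _ ≤ _ := Nat.mul_le_mul_right _ h2

/-- real version: `(FK).card * ∏ k ≥ n^n h(s) / n` -/
lemma FK_card' {n : ℕ} (hn : 0 < n) {K : Finset ℕ} (hK : ∀ k ∈ K, 0 < k) (hne : K.Nonempty) :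
    (n : ℝ) ^ n * hh n (∑ k ∈ K, k) / n ≤ ((FK n K).card : ℝ) * ∏ k ∈ K, (k : ℝ) := by
  set s := ∑ k ∈ K, k with hs
  have hs1 : 1 ≤ s := by
    obtain ⟨k, hk⟩ := hne
    have := single_le_sum (f := fun k : ℕ => k) (fun _ _ => Nat.zero_le _) hk
    have := hK k hk
    omega
  rcases le_or_gt s n with h | h
  · have h1 := FK_card hK h
    rw [← hs] at h1
    have h2 : (n.descFactorial s : ℝ) * ((s : ℝ) * (n : ℝ) ^ (n - s)) ≤ ((FK n K).card : ℝ) * (∏ k ∈ K, (k : ℝ)) * n := by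
      have h3 := (Nat.cast_le (α := ℝ)).mpr h1
      push_cast at h3
      exact h3
    rw [div_le_iff₀ (by positivity)]
    refine le_trans ?_ h2
    unfold hh
    have : (n : ℝ) ^ n = (n : ℝ) ^ (n - s) * (n : ℝ) ^ s := by rw [← pow_add]; congr 1; omega
    rw [this]
    have hn' : (n : ℝ) ^ s ≠ 0 := by positivity
    have e : (n : ℝ) ^ (n - s) * (n : ℝ) ^ s * ((n.descFactorial s : ℝ) / (n : ℝ) ^ s) = (n.descFactorial s : ℝ) * (1 * (n : ℝ) ^ (n - s)) := by
      field_simp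
    rw [e]
    gcongr
    exact_mod_cast hs1
  · have : hh n s = 0 := by unfold hh; rw [Nat.descFactorial_of_lt h]; simp
    rw [this, mul_zero, zero_div]
    positivity
end Comb

section Comb
open Finset

noncomputable def wj (j : ℕ) : ℝ := if j = 0 then 1 else 1 / (j : ℝ)

lemma wj_pos (j : ℕ) : 0 < wj j := by
  unfold wj
  split_ifs <;> positivity

noncomputable def ksup {P : Finset ℕ} (ka : {x // x ∈ P} → ℕ) : Finset {x // x ∈ P} :=
  univ.filter (fun p => ka p ≠ 0)

noncomputable def Kka {P : Finset ℕ} (ka : {x // x ∈ P} → ℕ) : Finset ℕ :=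
  (ksup ka).image (fun p => p.1 * ka p)

lemma pq_eq {J p q a b : ℕ} (hp : p.Prime) (hq : q.Prime) (hpJ : J < p)
    (hb : b ≤ J) (hb0 : b ≠ 0) (h : p * a = q * b) : p = q ∧ a = b := by
  have h1 : p ∣ q * b := ⟨a, h.symm⟩
  have hpq : p = q := by
    rcases (Nat.Prime.dvd_mul hp).mp h1 with h2 | h2
    · exact (Nat.prime_dvd_prime_iff_eq hp hq).mp h2
    · have := Nat.le_of_dvd (by omega) h2
      omega
  subst hpq
  exact ⟨rfl, Nat.eq_of_mul_eq_mul_left hp.pos h⟩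

lemma low_sum {n J : ℕ} (hn : 0 < n) {P : Finset ℕ} (hP : ∀ p ∈ P, p.Prime) (hJ : ∀ p ∈ P, J < p) :
    ∑ ka ∈ Fintype.piFinset (fun _ : {x // x ∈ P} => range (J + 1)),
      hh n (∑ p, p.1 * ka p) * ∏ p, wj (ka p) ≤ (n + 1) * ((∑ f : Fin n → Fin n, (T f : ℝ)) / (n : ℝ) ^ n) := by
  set Om := Fintype.piFinset (fun _ : {x // x ∈ P} => range (J + 1)) with hOm
  have hle : ∀ ka ∈ Om, ∀ p, ka p ≤ J := by
    intro ka hka p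
    rw [hOm, Fintype.mem_piFinset] at hka
    have := hka p
    rw [mem_range] at this
    omega
  have hnn : (0:ℝ) < (n : ℝ) ^ n := by positivity
  have hinjOn : ∀ ka ∈ Om, Set.InjOn (fun p : {x // x ∈ P} => p.1 * ka p) (ksup ka) := by
    intro ka hka p hp q hq h
    simp only [ksup, coe_filter, mem_univ, true_and, Set.mem_ofPred_eq] at hp hq
    exact Subtype.ext (pq_eq (hP _ p.2) (hP _ q.2) (hJ _ p.2) (hle ka hka q) hq h).1
  have hKsum : ∀ ka ∈ Om, ∑ k ∈ Kka ka, k = ∑ p, p.1 * ka p := by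
    intro ka hka
    rw [Kka, sum_image (hinjOn ka hka), ksup, sum_filter]
    refine sum_congr rfl fun p _ => ?_
    split_ifs with h
    · rfl
    · push Not at h; rw [h, mul_zero]
  have hKprod : ∀ ka ∈ Om, ∏ k ∈ Kka ka, (k : ℝ) = (∏ p ∈ ksup ka, (p.1 : ℝ)) * ∏ p ∈ ksup ka, (ka p : ℝ) := by
    intro ka hka
    rw [Kka, prod_image (hinjOn ka hka), ← prod_mul_distrib]
    push_cast
    rfl
  have hKpos : ∀ ka ∈ Om, ∀ k ∈ Kka ka, 0 < k := by
    intro ka hka k hk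
    simp only [Kka, mem_image, ksup, mem_filter, mem_univ, true_and] at hk
    obtain ⟨p, hp, rfl⟩ := hk
    exact Nat.mul_pos (hP _ p.2).pos (Nat.pos_of_ne_zero hp)
  have hw : ∀ ka : {x // x ∈ P} → ℕ, ∏ p, wj (ka p) = (∏ p ∈ ksup ka, (ka p : ℝ))⁻¹ := by
    intro ka
    rw [ksup, prod_filter, ← prod_inv_distrib]
    refine prod_congr rfl fun p _ => ?_
    unfold wj
    by_cases h : ka p = 0 <;> simp [h]
  have hTge : ∀ ka ∈ Om, ∀ f ∈ FK n (Kka ka), (∏ p ∈ ksup ka, (p.1 : ℝ)) ≤ T f := by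
    intro ka hka f hf
    have hdvd : ∏ p ∈ ksup ka, p.1 ∣ T f := by
      apply Finset.prod_dvd_of_isRelPrime
      · intro p _ q _ hne
        rw [Function.onFun, ← Nat.coprime_iff_isRelPrime, Nat.coprime_primes (hP _ p.2) (hP _ q.2)]
        exact fun h => hne (Subtype.ext h)
      · intro p hp
        have hmem : p.1 * ka p ∈ perset f := by
          simp only [FK, mem_filter, mem_univ, true_and] at hf
          rw [hf.1]
          exact mem_image_of_mem _ hp
        simp only [perset, mem_filter, mem_image, mem_univ, true_and] at hmem
        obtain ⟨⟨v, hv⟩, h0⟩ := hmem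
        have := dvd_T f (v := v) (by rw [hv]; exact h0)
        rw [hv] at this
        exact (Dvd.intro _ rfl).trans this
    have := Nat.le_of_dvd (T_mem f).1 hdvd
    exact_mod_cast this
  have hinj : ∀ ka ∈ Om, ∀ kb ∈ Om, Kka ka = Kka kb → ka = kb := by
    have aux : ∀ ka ∈ Om, ∀ kb ∈ Om, Kka ka = Kka kb → ∀ p, ka p ≠ 0 → ka p = kb p := by
      intro ka hka kb hkb h p hp
      have : p.1 * ka p ∈ Kka kb := by
        rw [← h]
        exact mem_image_of_mem _ (by simp [ksup, hp])
      simp only [Kka, mem_image, ksup, mem_filter, mem_univ, true_and] at this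
      obtain ⟨q, hq, he⟩ := this
      obtain ⟨h1, h2⟩ := pq_eq (hP _ p.2) (hP _ q.2) (hJ _ p.2) (hle kb hkb q) hq he.symm
      rw [h2, Subtype.ext h1]
    intro ka hka kb hkb h
    funext p
    by_cases hp : ka p = 0
    · by_cases hq : kb p = 0
      · rw [hp, hq]
      · exact (aux kb hkb ka hka h.symm p hq).symm
    · exact aux ka hka kb hkb h p hp
  -- main term
  have hmain : ∑ ka ∈ Om.erase 0, hh n (∑ p, p.1 * ka p) * ∏ p, wj (ka p) ≤ n * ((∑ f : Fin n → Fin n, (T f : ℝ)) / (n : ℝ) ^ n) := by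
    have h1 : ∑ ka ∈ Om.erase 0, ∑ f ∈ FK n (Kka ka), (T f : ℝ) ≤ ∑ f : Fin n → Fin n, (T f : ℝ) := by
      rw [← sum_biUnion]
      · exact sum_le_sum_of_subset_of_nonneg (subset_univ _) (fun _ _ _ => by positivity)
      · intro ka hka kb hkb hne
        rw [Function.onFun, Finset.disjoint_left]
        intro f hf hf'
        simp only [FK, mem_filter, mem_univ, true_and] at hf hf'
        apply hne
        simp only [coe_erase, Set.mem_sdiff, mem_coe] at hka hkb
        exact hinj ka hka.1 kb hkb.1 (hf.1.symm.trans hf'.1)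
    rw [← mul_div_assoc, le_div_iff₀ hnn, sum_mul]
    refine le_trans ?_ (mul_le_mul_of_nonneg_left h1 (by positivity))
    rw [mul_sum]
    apply sum_le_sum
    intro ka hka
    obtain ⟨hne, hka⟩ := mem_erase.mp hka
    have hKne : (Kka ka).Nonempty := by
      obtain ⟨p, hp⟩ := Function.ne_iff.mp hne
      exact ⟨_, mem_image_of_mem _ (show p ∈ ksup ka by simp only [ksup, mem_filter, mem_univ, true_and]; exact hp)⟩
    have h2 := FK_card' hn (hKpos ka hka) hKne
    rw [hKsum ka hka, hKprod ka hka] at h2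
    have hpos : 0 < ∏ p ∈ ksup ka, (ka p : ℝ) := by
      apply prod_pos
      intro p hp
      simp only [ksup, mem_filter, mem_univ, true_and] at hp
      exact_mod_cast Nat.pos_of_ne_zero hp
    have h3 : ((FK n (Kka ka)).card : ℝ) * (∏ p ∈ ksup ka, (p.1 : ℝ)) ≤ ∑ f ∈ FK n (Kka ka), (T f : ℝ) := by
      rw [← nsmul_eq_mul]
      exact card_nsmul_le_sum _ _ _ (hTge ka hka)
    have hn' : (0:ℝ) < n := by positivity
    refine le_trans ?_ (mul_le_mul_of_nonneg_left h3 hn'.le)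
    rw [hw ka, div_le_iff₀ hn'] at *
    calc hh n (∑ p, p.1 * ka p) * (∏ p ∈ ksup ka, (ka p : ℝ))⁻¹ * (n : ℝ) ^ n
        = ((n : ℝ) ^ n * hh n (∑ p, p.1 * ka p)) * (∏ p ∈ ksup ka, (ka p : ℝ))⁻¹ := by ring
      _ ≤ (((FK n (Kka ka)).card : ℝ) * ((∏ p ∈ ksup ka, (p.1 : ℝ)) * ∏ p ∈ ksup ka, (ka p : ℝ)) * n) * (∏ p ∈ ksup ka, (ka p : ℝ))⁻¹ := by
          gcongr
      _ = _ := by field_simp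
  have hE1 : 1 ≤ (∑ f : Fin n → Fin n, (T f : ℝ)) / (n : ℝ) ^ n := by
    rw [one_le_div hnn]
    calc (n : ℝ) ^ n = ∑ f : Fin n → Fin n, (1 : ℝ) := by simp
      _ ≤ _ := sum_le_sum fun f _ => by exact_mod_cast (T_mem f).1
  have h0 : (0 : {x // x ∈ P} → ℕ) ∈ Om := by
    rw [hOm, Fintype.mem_piFinset]; intro p; simp
  rw [← add_sum_erase _ _ h0]
  have e0 : hh n (∑ p : {x // x ∈ P}, p.1 * (0 : {x // x ∈ P} → ℕ) p) * ∏ p : {x // x ∈ P}, wj ((0 : {x // x ∈ P} → ℕ) p) = 1 := by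
    simp [hh_zero, wj]
  rw [e0]
  linarith
end Comb

section Jensen
open Finset

lemma pi_exp1 {ι : Type*} [Fintype ι] [DecidableEq ι] (R : Finset ℕ) (v : ι → ℕ → ℝ) (hv : ∀ i, ∑ j ∈ R, v i j = 1)
    (φ : ι → ℕ → ℝ) (a : ι) :
    ∑ ka ∈ Fintype.piFinset (fun _ : ι => R), (∏ i, v i (ka i)) * φ a (ka a) = ∑ j ∈ R, v a j * φ a j := by
  have h := Finset.prod_univ_sum (fun _ : ι => R) (fun i j => v i j * (if i = a then φ i j else 1))
  have h2 : ∀ i, ∑ j ∈ R, v i j * (if i = a then φ i j else 1) = if i = a then ∑ j ∈ R, v i j * φ i j else 1 := by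
    intro i
    split_ifs with h
    · rfl
    · simp [hv i]
  simp_rw [h2] at h
  rw [Finset.prod_ite_eq' univ a] at h
  simp only [mem_univ, if_true] at h
  rw [h]
  refine sum_congr rfl fun ka _ => ?_
  rw [prod_mul_distrib, Finset.prod_ite_eq' univ a]
  simp

lemma pi_exp2 {ι : Type*} [Fintype ι] [DecidableEq ι] (R : Finset ℕ) (v : ι → ℕ → ℝ) (hv : ∀ i, ∑ j ∈ R, v i j = 1)
    (φ : ι → ℕ → ℝ) {a b : ι} (hab : a ≠ b) :
    ∑ ka ∈ Fintype.piFinset (fun _ : ι => R), (∏ i, v i (ka i)) * (φ a (ka a) * φ b (ka b))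
      = (∑ j ∈ R, v a j * φ a j) * (∑ j ∈ R, v b j * φ b j) := by
  have h := Finset.prod_univ_sum (fun _ : ι => R) (fun i j => v i j * ((if i = a then φ i j else 1) * (if i = b then φ i j else 1)))
  have h2 : ∀ i, ∑ j ∈ R, v i j * ((if i = a then φ i j else 1) * (if i = b then φ i j else 1)) =
      (if i = a then ∑ j ∈ R, v i j * φ i j else 1) * (if i = b then ∑ j ∈ R, v i j * φ i j else 1) := by
    intro i
    by_cases h1 : i = a
    · have : i ≠ b := by rw [h1]; exact hab
      simp [h1, hab]
    · by_cases h3 : i = b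
      · simp [h3, hab.symm]
      · simp [h1, h3, hv i]
  simp_rw [h2] at h
  rw [prod_mul_distrib, Finset.prod_ite_eq' univ a, Finset.prod_ite_eq' univ b] at h
  simp only [mem_univ, if_true] at h
  rw [h]
  refine sum_congr rfl fun ka _ => ?_
  rw [prod_mul_distrib, prod_mul_distrib, Finset.prod_ite_eq' univ a, Finset.prod_ite_eq' univ b]
  simp

lemma pi_var {ι : Type*} [Fintype ι] [DecidableEq ι] (R : Finset ℕ) (v : ι → ℕ → ℝ) (hv : ∀ i, ∑ j ∈ R, v i j = 1)
    (hv0 : ∀ i j, 0 ≤ v i j) (φ : ι → ℕ → ℝ) (C : ι → ℝ) (hC : ∀ i, ∀ j ∈ R, φ i j ^ 2 ≤ C i) :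
    ∑ ka ∈ Fintype.piFinset (fun _ : ι => R), (∏ i, v i (ka i)) * (∑ i, φ i (ka i)) ^ 2
      ≤ (∑ i, ∑ j ∈ R, v i j * φ i j) ^ 2 + ∑ i, C i := by
  have h1 : ∀ ka : ι → ℕ, (∏ i, v i (ka i)) * (∑ i, φ i (ka i)) ^ 2 =
      ∑ a, ∑ b, (∏ i, v i (ka i)) * (φ a (ka a) * φ b (ka b)) := by
    intro ka
    rw [sq, sum_mul_sum, mul_sum]
    simp_rw [mul_sum]
  simp_rw [h1]
  rw [sum_comm]
  have h2 : (∑ i, ∑ j ∈ R, v i j * φ i j) ^ 2 + ∑ i, C i =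
      ∑ a, ∑ b, ((∑ j ∈ R, v a j * φ a j) * (∑ j ∈ R, v b j * φ b j) + if a = b then C a else 0) := by
    simp_rw [sum_add_distrib]
    rw [sq, sum_mul_sum]
    simp
  rw [h2]
  refine sum_le_sum fun a _ => ?_
  rw [sum_comm]
  refine sum_le_sum fun b _ => ?_
  by_cases hab : a = b
  · subst hab
    rw [pi_exp1 R v hv (fun i j => φ i j * φ i j) a]
    simp only [if_true]
    have : ∑ j ∈ R, v a j * (φ a j * φ a j) ≤ C a := by
      calc _ ≤ ∑ j ∈ R, v a j * C a := by
            refine sum_le_sum fun j hj => mul_le_mul_of_nonneg_left ?_ (hv0 a j)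
            rw [← sq]; exact hC a j hj
        _ = C a := by rw [← sum_mul, hv, one_mul]
    nlinarith [mul_self_nonneg (∑ j ∈ R, v a j * φ a j)]
  · rw [pi_exp2 R v hv φ hab]
    simp [hab]

noncomputable def GJ (J : ℕ) (t : ℝ) : ℝ := ∑ j ∈ range (J + 1), wj j * Real.exp (-(j * t))
noncomputable def HJ (J : ℕ) (t : ℝ) : ℝ := ∑ j ∈ range (J + 1), j * (wj j * Real.exp (-(j * t)))

lemma GJ_pos (J : ℕ) (t : ℝ) : 0 < GJ J t := by
  unfold GJ
  exact sum_pos (fun j _ => mul_pos (wj_pos j) (Real.exp_pos _)) (by simp)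

lemma low_bound {n J : ℕ} (hn : 0 < n) {P : Finset ℕ} (hP : ∀ p ∈ P, p.Prime) (hJ : ∀ p ∈ P, J < p)
    {N : ℝ} (hN : 0 < N) (hs : 2 * ∑ p ∈ P, p * J ≤ n) :
    ∑ p ∈ P, Real.log (GJ J (p / N)) + (∑ p ∈ P, p * (HJ J (p / N) / GJ J (p / N))) / N
      - ((∑ p ∈ P, p * (HJ J (p / N) / GJ J (p / N))) ^ 2 + ∑ p ∈ P, ((p : ℝ) * J) ^ 2) / (2 * n)
      - (∑ p ∈ P, (p : ℝ) * J) ^ 3 / n ^ 2 ≤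
    Real.log ((n + 1) * ((∑ f : Fin n → Fin n, (T f : ℝ)) / (n : ℝ) ^ n)) := by
  set R := range (J + 1) with hR
  let v : {x // x ∈ P} → ℕ → ℝ := fun p j => wj j * Real.exp (-(j * (p.1 / N))) / GJ J (p.1 / N)
  let φ : {x // x ∈ P} → ℕ → ℝ := fun p j => (p.1 : ℝ) * j
  have hv : ∀ i, ∑ j ∈ R, v i j = 1 := by
    intro i
    simp only [v]
    rw [← sum_div]
    exact div_self (GJ_pos J _).ne'
  have hv0 : ∀ i j, 0 ≤ v i j := fun i j => div_nonneg (mul_nonneg (wj_pos j).le (Real.exp_pos _).le) (GJ_pos J _).le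
  have hm : ∀ i : {x // x ∈ P}, ∑ j ∈ R, v i j * φ i j = i.1 * (HJ J (i.1 / N) / GJ J (i.1 / N)) := by
    intro i
    simp only [v, φ, HJ]
    rw [sum_div, mul_sum]
    refine sum_congr rfl fun j _ => ?_
    ring
  set s0 := ∑ p ∈ P, p * (HJ J (p / N) / GJ J (p / N)) with hs0
  have hs0' : ∑ i, ∑ j ∈ R, v i j * φ i j = s0 := by
    simp_rw [hm]
    rw [hs0]
    exact sum_coe_sort P (fun p : ℕ => (p:ℝ) * (HJ J (p / N) / GJ J (p / N)))
  set Om := Fintype.piFinset (fun _ : {x // x ∈ P} => R) with hOm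
  have hsum1 : ∑ ka ∈ Om, ∏ i, v i (ka i) = 1 := by
    rw [hOm, ← Finset.prod_univ_sum (fun _ => R)]
    exact prod_eq_one fun i _ => hv i
  have hvar := pi_var R v hv hv0 φ (fun p => ((p.1 : ℝ) * J) ^ 2) (by
    intro i j hj
    have : (j:ℝ) ≤ J := by
      rw [hR, mem_range] at hj
      exact_mod_cast Nat.lt_succ_iff.mp hj
    simp only [φ]
    gcongr)
  rw [hs0', sum_coe_sort P (fun p : ℕ => ((p:ℝ) * J) ^ 2), ← hOm] at hvar
  have hmean : ∑ ka ∈ Om, (∏ i, v i (ka i)) * (∑ i, φ i (ka i)) = s0 := by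
    simp_rw [mul_sum]
    rw [sum_comm, ← hs0']
    exact sum_congr rfl fun a _ => pi_exp1 R v hv φ a
  set V := ∑ p ∈ P, ((p : ℝ) * J) ^ 2
  set sm := ∑ p ∈ P, (p : ℝ) * J with hsm
  have hn' : (0:ℝ) < n := by exact_mod_cast hn
  have hjen := convexOn_exp.map_sum_le (t := Om) (w := fun ka => ∏ i, v i (ka i))
    (p := fun ka => (∑ i, φ i (ka i)) / N - (∑ i, φ i (ka i)) ^ 2 / (2 * n) - sm ^ 3 / n ^ 2)
    (fun ka _ => prod_nonneg fun i _ => hv0 i _) hsum1 (fun _ _ => Set.mem_univ _)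
  simp only [smul_eq_mul] at hjen
  have hexp : s0 / N - (s0 ^ 2 + V) / (2 * n) - sm ^ 3 / n ^ 2 ≤
      ∑ ka ∈ Om, (∏ i, v i (ka i)) * ((∑ i, φ i (ka i)) / N - (∑ i, φ i (ka i)) ^ 2 / (2 * n) - sm ^ 3 / n ^ 2) := by
    simp_rw [mul_sub, sum_sub_distrib, ← mul_div_assoc]
    rw [← sum_div, ← sum_div, ← sum_div, ← sum_mul, hmean, hsum1, one_mul]
    gcongr
  have hGp : (0:ℝ) < ∏ p ∈ P, GJ J (p / N) := prod_pos fun p _ => GJ_pos J _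
  have hlow := low_sum hn hP hJ
  rw [← hR, ← hOm] at hlow
  have hterm : (∏ p ∈ P, GJ J (p / N)) * ∑ ka ∈ Om, (∏ i, v i (ka i)) * Real.exp ((∑ i, φ i (ka i)) / N - (∑ i, φ i (ka i)) ^ 2 / (2 * n) - sm ^ 3 / n ^ 2)
     ≤ ∑ ka ∈ Om, hh n (∑ p, p.1 * ka p) * ∏ p, wj (ka p) := by
    rw [mul_sum]
    refine sum_le_sum fun ka hka => ?_
    have hka' : ∀ p, ka p ≤ J := by
      intro p
      rw [hOm, Fintype.mem_piFinset] at hka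
      have := hka p
      rw [hR, mem_range] at this
      omega
    have e1 : ∑ i, φ i (ka i) = ((∑ p, p.1 * ka p : ℕ) : ℝ) := by
      push_cast; rfl
    have e2 : ∑ p, p.1 * ka p ≤ ∑ p ∈ P, p * J := by
      rw [← sum_coe_sort P (fun p => p * J)]
      exact sum_le_sum fun p _ => Nat.mul_le_mul_left _ (hka' p)
    have e3 : ((∑ p, p.1 * ka p : ℕ) : ℝ) ≤ sm := by
      rw [hsm]; exact_mod_cast e2
    have e4 := hh_ge hn (s := ∑ p, p.1 * ka p) (by omega)
    have e5 : (∏ p ∈ P, GJ J (p / N)) * (∏ i, v i (ka i)) = (∏ p, wj (ka p)) * Real.exp (-((∑ i, φ i (ka i)) / N)) := by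
      rw [← prod_coe_sort P (fun p : ℕ => GJ J (p / N)), ← prod_mul_distrib]
      have : ∀ i : {x // x ∈ P}, GJ J (i.1 / N) * v i (ka i) = wj (ka i) * Real.exp (-(φ i (ka i) / N)) := by
        intro i
        simp only [v, φ]
        rw [mul_div_cancel₀ _ (GJ_pos J _).ne']
        congr 3; ring
      rw [prod_congr rfl fun i _ => this i, prod_mul_distrib, ← Real.exp_sum, sum_neg_distrib, sum_div]
    rw [← mul_assoc, e5, mul_assoc, ← Real.exp_add, mul_comm]
    refine mul_le_mul_of_nonneg_right ?_ (prod_nonneg fun p _ => (wj_pos _).le)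
    refine le_trans ?_ e4
    rw [e1]
    apply Real.exp_le_exp.mpr
    have : ((∑ p, p.1 * ka p : ℕ) : ℝ) ^ 3 / n ^ 2 ≤ sm ^ 3 / n ^ 2 := by gcongr
    linarith
  have hfin : (∏ p ∈ P, GJ J (p / N)) * Real.exp (s0 / N - (s0 ^ 2 + V) / (2 * n) - sm ^ 3 / n ^ 2) ≤
      (n + 1) * ((∑ f : Fin n → Fin n, (T f : ℝ)) / (n : ℝ) ^ n) :=
    (mul_le_mul_of_nonneg_left ((Real.exp_le_exp.mpr hexp).trans hjen) hGp.le).trans (hterm.trans hlow)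
  have := Real.log_le_log (mul_pos hGp (Real.exp_pos _)) hfin
  rw [Real.log_mul hGp.ne' (Real.exp_pos _).ne', Real.log_exp, Real.log_prod (fun p _ => (GJ_pos J _).ne')] at this
  linarith
end Jensen

section Ana
open Real Set Filter Topology MeasureTheory Chebyshev

lemma theta_scale (t : ℝ) (ht : 0 < t) : Tendsto (fun N : ℝ => theta (t * N) / N) atTop (𝓝 t) := by
  have h := theta_div_tendsto.comp (tendsto_id.const_mul_atTop ht)
  have h2 := h.mul_const t
  rw [one_mul] at h2
  refine h2.congr' ?_
  filter_upwards [eventually_gt_atTop 0] with N hN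
  simp only [Function.comp_apply, id]
  field_simp

lemma theta_scale_le {t N : ℝ} (ht : 0 ≤ t) (hN : 0 < N) : theta (t * N) / N ≤ log 4 * t := by
  rw [div_le_iff₀ hN, mul_assoc]
  exact theta_le_log4_mul_x (by positivity)

noncomputable def PP (a b N : ℝ) : Finset ℕ := (Finset.Ioc ⌊a * N⌋₊ ⌊b * N⌋₊).filter Nat.Prime

lemma abel_id {φ : ℝ → ℝ} (hφ : ContDiff ℝ 1 φ) {a b N : ℝ} (ha : 0 < a) (hab : a ≤ b) (hN : 0 < N) :
    ∑ p ∈ PP a b N, log p * φ (p / N) = φ b * theta (b * N) - φ a * theta (a * N)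
      - ∫ t in a..b, deriv φ t * theta (t * N) := by
  have hd : Differentiable ℝ φ := hφ.differentiable (by norm_num)
  have hdc : Continuous (deriv φ) := hφ.continuous_deriv (by norm_num)
  have hder : deriv (fun x => φ (x / N)) = fun x => deriv φ (x / N) / N := by
    funext x
    have : HasDerivAt (fun x => φ (x / N)) (deriv φ (x / N) * (1 / N)) x :=
      (hd (x / N)).hasDerivAt.comp x ((hasDerivAt_id x).div_const N)
    rw [this.deriv]; ring
  have h := sum_mul_eq_sub_sub_integral_mul (f := fun x => φ (x / N)) (a := a * N) (b := b * N)
    (fun k : ℕ => if k.Prime then log k else 0) (by positivity) (by gcongr)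
    (fun t _ => (hd (t / N)).comp t (by fun_prop))
    (by rw [hder]
        have : Continuous (fun x => deriv φ (x / N) / N) := by fun_prop
        exact this.integrableOn_Icc)
  have hth : ∀ x, ∑ k ∈ Finset.Icc 0 ⌊x⌋₊, (if k.Prime then log (k:ℝ) else 0) = theta x := by
    intro x; rw [theta_eq_sum_Icc, Finset.sum_filter]
  simp only [hth, hder] at h
  rw [PP, Finset.sum_filter]
  have e1 : ∑ k ∈ Finset.Ioc ⌊a * N⌋₊ ⌊b * N⌋₊, φ ((k:ℝ) / N) * (if k.Prime then log (k:ℝ) else 0) =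
      ∑ p ∈ Finset.Ioc ⌊a * N⌋₊ ⌊b * N⌋₊, if p.Prime then log (p:ℝ) * φ (p / N) else 0 := by
    refine Finset.sum_congr rfl fun k _ => ?_
    split_ifs <;> ring
  rw [← e1, h, mul_div_cancel_right₀ _ hN.ne', mul_div_cancel_right₀ _ hN.ne']
  congr 1
  rw [← intervalIntegral.integral_of_le (by gcongr)]
  have h3 := intervalIntegral.integral_comp_mul_right (a := a) (b := b) (fun t => deriv φ (t / N) / N * theta t) hN.ne'
  rw [smul_eq_mul, eq_comm, inv_mul_eq_iff_eq_mul₀ hN.ne'] at h3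
  rw [h3, ← intervalIntegral.integral_const_mul]
  congr 1
  funext t
  rw [mul_div_cancel_right₀ _ hN.ne']
  field_simp

lemma sum_prime_tendsto {φ : ℝ → ℝ} (hφ : ContDiff ℝ 1 φ) {a b : ℝ} (ha : 0 < a) (hab : a ≤ b) :
    Tendsto (fun N : ℝ => (∑ p ∈ PP a b N, log p * φ (p / N)) / N) atTop (𝓝 (∫ t in a..b, φ t)) := by
  have hd : Differentiable ℝ φ := hφ.differentiable (by norm_num)
  have hdc : Continuous (deriv φ) := hφ.continuous_deriv (by norm_num)
  have hb : 0 < b := ha.trans_le hab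
  have hlim : Tendsto (fun N : ℝ => ∫ t in a..b, deriv φ t * (theta (t * N) / N)) atTop (𝓝 (∫ t in a..b, deriv φ t * t)) := by
    refine intervalIntegral.tendsto_integral_filter_of_dominated_convergence (fun t => |deriv φ t| * (log 4 * b)) ?_ ?_ ?_ ?_
    · refine Eventually.of_forall fun N => ?_
      have : Measurable (theta) := theta_mono.measurable
      exact (hdc.measurable.mul ((this.comp (measurable_id.mul_const N)).div_const N)).aestronglyMeasurable
    · filter_upwards [eventually_gt_atTop 0] with N hN
      refine ae_of_all _ fun t ht => ?_
      rw [uIoc_of_le hab] at ht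
      have h0 : 0 ≤ t := by linarith [ht.1]
      rw [norm_mul, Real.norm_eq_abs, Real.norm_of_nonneg (div_nonneg (theta_nonneg _) hN.le)]
      gcongr
      refine (theta_scale_le h0 hN).trans ?_
      have : 0 ≤ log 4 := log_nonneg (by norm_num)
      exact mul_le_mul_of_nonneg_left ht.2 this
    · exact (hdc.abs.mul continuous_const).intervalIntegrable _ _
    · refine ae_of_all _ fun t ht => ?_
      rw [uIoc_of_le hab] at ht
      exact (theta_scale t (ha.trans ht.1)).const_mul _
  have hparts := intervalIntegral.integral_mul_deriv_eq_deriv_mul (a := a) (b := b) (u := fun t => t) (v := φ) (u' := fun _ => 1) (v' := deriv φ)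
    (fun x _ => hasDerivAt_id x) (fun x _ => (hd x).hasDerivAt) (continuous_const.intervalIntegrable _ _) (hdc.intervalIntegrable _ _)
  simp only [one_mul] at hparts
  have heq : ∫ t in a..b, φ t = φ b * b - φ a * a - ∫ t in a..b, deriv φ t * t := by
    simp_rw [mul_comm (deriv φ _)]
    rw [hparts]; ring
  rw [heq]
  refine ((((theta_scale b hb).const_mul (φ b)).sub ((theta_scale a ha).const_mul (φ a))).sub hlim).congr' ?_
  filter_upwards [eventually_gt_atTop 0] with N hN
  rw [abel_id hφ ha hab hN, sub_div, sub_div, ← intervalIntegral.integral_div]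
  simp_rw [mul_div_assoc]

lemma log_add_const_div (c : ℝ) (hc : 0 < c) : Tendsto (fun N : ℝ => log N / log (c * N)) atTop (𝓝 1) := by
  have h1 : Tendsto (fun N : ℝ => 1 + log c / log N) atTop (𝓝 (1 + 0)) :=
    tendsto_const_nhds.add (tendsto_const_nhds.div_atTop tendsto_log_atTop)
  have h2 := h1.inv₀ (by norm_num)
  simp only [add_zero, inv_one] at h2
  refine h2.congr' ?_
  filter_upwards [eventually_gt_atTop 1] with N hN
  have : 0 < log N := log_pos hN
  have h3 : 1 + log c / log N = (log c + log N) / log N := by rw [add_div, div_self this.ne', add_comm]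
  rw [log_mul hc.ne' (by linarith), h3, inv_div]

lemma sum_prime_tendsto' {φ : ℝ → ℝ} (hφ : ContDiff ℝ 1 φ) {a b : ℝ} (ha : 0 < a) (hab : a ≤ b)
    (h0 : ∀ t, 0 < t → 0 ≤ φ t) :
    Tendsto (fun N : ℝ => (∑ p ∈ PP a b N, φ (p / N)) * log N / N) atTop (𝓝 (∫ t in a..b, φ t)) := by
  have hb : 0 < b := ha.trans_le hab
  have hS := sum_prime_tendsto hφ ha hab
  have hl := hS.mul (log_add_const_div b hb)
  have hu := hS.mul (log_add_const_div a ha)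
  rw [mul_one] at hl hu
  have hmem : ∀ N : ℝ, 0 < N → ∀ p ∈ PP a b N, a * N < p ∧ (p : ℝ) ≤ b * N := by
    intro N hN p hp
    simp only [PP, Finset.mem_filter, Finset.mem_Ioc] at hp
    exact ⟨(Nat.floor_lt (by positivity)).mp hp.1.1, (Nat.le_floor_iff (by positivity)).mp hp.1.2⟩
  have hev : ∀ᶠ N : ℝ in atTop, 1 < N ∧ 1 < a * N ∧ 1 < b * N :=
    (eventually_gt_atTop 1).and (((tendsto_id.const_mul_atTop ha).eventually_gt_atTop 1).and ((tendsto_id.const_mul_atTop hb).eventually_gt_atTop 1))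
  refine tendsto_of_tendsto_of_tendsto_of_le_of_le' hl hu ?_ ?_
  · filter_upwards [hev] with N ⟨hN, h1, h2⟩
    have hN0 : 0 < N := by linarith
    have hlN : 0 < log N := log_pos hN
    have hlb : 0 < log (b * N) := log_pos h2
    rw [div_mul_div_comm, div_le_div_iff₀ (by positivity) hN0]
    have : ∑ p ∈ PP a b N, log p * φ (p / N) ≤ (∑ p ∈ PP a b N, φ (p / N)) * log (b * N) := by
      rw [Finset.sum_mul]
      refine Finset.sum_le_sum fun p hp => ?_
      obtain ⟨h3, h4⟩ := hmem N hN0 p hp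
      rw [mul_comm]
      refine mul_le_mul_of_nonneg_left (log_le_log (by linarith) h4) (h0 _ (div_pos (by linarith) hN0))
    calc _ = (∑ p ∈ PP a b N, log p * φ (p / N)) * (log N * N) := by ring
      _ ≤ ((∑ p ∈ PP a b N, φ (p / N)) * log (b * N)) * (log N * N) := by gcongr
      _ = _ := by ring
  · filter_upwards [hev] with N ⟨hN, h1, h2⟩
    have hN0 : 0 < N := by linarith
    have hlN : 0 < log N := log_pos hN
    have hlb : 0 < log (a * N) := log_pos h1
    rw [div_mul_div_comm, div_le_div_iff₀ hN0 (by positivity)]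
    have : (∑ p ∈ PP a b N, φ (p / N)) * log (a * N) ≤ ∑ p ∈ PP a b N, log p * φ (p / N) := by
      rw [Finset.sum_mul]
      refine Finset.sum_le_sum fun p hp => ?_
      obtain ⟨h3, h4⟩ := hmem N hN0 p hp
      rw [mul_comm]
      refine mul_le_mul_of_nonneg_right (log_le_log (by linarith) h3.le) (h0 _ (div_pos (by linarith) hN0))
    calc _ = ((∑ p ∈ PP a b N, φ (p / N)) * log (a * N)) * (log N * N) := by ring
      _ ≤ (∑ p ∈ PP a b N, log p * φ (p / N)) * (log N * N) := by gcongr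
      _ = _ := by ring
end Ana

section Ana
open Real Set Filter Topology MeasureTheory Chebyshev

noncomputable def gL (t : ℝ) : ℝ := log (1 - log (1 - exp (-t)))
noncomputable def dL (t : ℝ) : ℝ := exp (-t) / (1 - exp (-t)) / (1 - log (1 - exp (-t)))

lemma om_pos {t : ℝ} (ht : 0 < t) : 0 < 1 - exp (-t) := by
  have : exp (-t) < 1 := by simpa using ht
  linarith

lemma oml_pos {t : ℝ} (ht : 0 < t) : 1 < 1 - log (1 - exp (-t)) := by
  have := log_neg (om_pos ht) (by linarith [exp_pos (-t)])
  linarith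

lemma gL_eq {t : ℝ} (ht : 0 < t) : log (log (exp 1 / (1 - exp (-t)))) = gL t := by
  rw [gL, log_div (exp_pos 1).ne' (om_pos ht).ne', log_exp]

lemma gL_pos {t : ℝ} (ht : 0 < t) : 0 < gL t := log_pos (oml_pos ht)

lemma dL_nonneg {t : ℝ} (ht : 0 < t) : 0 ≤ dL t :=
  div_nonneg (div_nonneg (exp_pos _).le (om_pos ht).le) (by linarith [oml_pos ht])

lemma gL_hasDeriv {t : ℝ} (ht : 0 < t) : HasDerivAt gL (-dL t) t := by
  have h1 : HasDerivAt (fun t : ℝ => 1 - exp (-t)) (exp (-t)) t := by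
    have := ((hasDerivAt_neg t).exp).const_sub 1
    simpa using this
  have h2 := ((h1.log (om_pos ht).ne').const_sub 1).log (by linarith [oml_pos ht])
  refine h2.congr_deriv ?_
  rw [dL]; ring

lemma exp_sub_one_ge {t : ℝ} (ht : 0 < t) : t * exp (t / 2) ≤ exp t - 1 := by
  have h1 : t / 2 ≤ sinh (t / 2) := self_le_sinh_iff.mpr (by linarith)
  rw [sinh_eq] at h1
  have h2 : exp t = exp (t / 2) * exp (t / 2) := by rw [← exp_add]; ring_nf
  have h3 : exp (t / 2) * exp (-(t / 2)) = 1 := by rw [← exp_add]; simp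
  nlinarith [exp_pos (t / 2)]

lemma zeq {t : ℝ} (ht : 0 < t) : exp (-t) / (1 - exp (-t)) = 1 / (exp t - 1) := by
  have h1 := om_pos ht
  have h2 : 0 < exp t - 1 := by have := one_lt_exp_iff.mpr ht; linarith
  have h3 : exp (-t) * exp t = 1 := by rw [← exp_add]; simp
  rw [div_eq_div_iff h1.ne' h2.ne']
  linarith

lemma z_le {t : ℝ} (ht : 0 < t) : exp (-t) / (1 - exp (-t)) ≤ 1 / t * exp (-(t / 2)) := by
  rw [zeq ht, exp_neg, one_div_mul_eq_div, div_eq_mul_inv _ t, ← mul_inv, one_div, mul_comm]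
  exact inv_anti₀ (by positivity) (exp_sub_one_ge ht)

lemma tdL_le {t : ℝ} (ht : 0 < t) : t * dL t ≤ exp (-(t / 2)) := by
  have h1 : dL t ≤ exp (-t) / (1 - exp (-t)) :=
    div_le_self (div_nonneg (exp_pos _).le (om_pos ht).le) (oml_pos ht).le
  calc t * dL t ≤ t * (1 / t * exp (-(t / 2))) := by
        gcongr; exact h1.trans (z_le ht)
    _ = _ := by field_simp

lemma gL_le_log {t : ℝ} (ht : 0 < t) : gL t ≤ -log (1 - exp (-t)) := by
  have := log_le_sub_one_of_pos (show 0 < 1 - log (1 - exp (-t)) by linarith [oml_pos ht])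
  rw [gL]; linarith

lemma neglog_eq {t : ℝ} (ht : 0 < t) : -log (1 - exp (-t)) = log (1 + exp (-t) / (1 - exp (-t))) := by
  rw [← log_inv]
  congr 1
  have := om_pos ht
  field_simp
  ring

lemma gL_le {t : ℝ} (ht : 0 < t) : gL t ≤ 2 * (t ^ (-(1/2) : ℝ) * exp (-(1/4) * t)) := by
  have hz0 : 0 ≤ exp (-t) / (1 - exp (-t)) := div_nonneg (exp_pos _).le (om_pos ht).le
  set z := exp (-t) / (1 - exp (-t)) with hz
  have h1 : log (1 + z) ≤ 2 * √z := by
    have : 1 + z ≤ (1 + √z) ^ 2 := by nlinarith [sq_sqrt hz0, sqrt_nonneg z]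
    calc log (1 + z) ≤ log ((1 + √z) ^ 2) := log_le_log (by linarith) this
      _ = 2 * log (1 + √z) := by rw [log_pow]; norm_num
      _ ≤ 2 * √z := by
        have := log_le_sub_one_of_pos (show 0 < 1 + √z by positivity)
        linarith
  have h2 : √z ≤ t ^ (-(1/2) : ℝ) * exp (-(1/4) * t) := by
    rw [sqrt_le_left (by positivity)]
    refine (z_le ht).trans (le_of_eq ?_)
    rw [mul_pow, ← rpow_natCast (t ^ _), ← rpow_mul ht.le, ← exp_nat_mul]
    norm_num
    rw [rpow_neg_one]
    ring_nf
  have := gL_le_log ht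
  rw [neglog_eq ht, ← hz] at this
  linarith

lemma gL_cont : ContinuousOn gL (Ioi 0) := fun t ht => (gL_hasDeriv ht).continuousAt.continuousWithinAt

lemma gL_bound_int : IntegrableOn (fun t : ℝ => 2 * (t ^ (-(1/2) : ℝ) * exp (-(1/4) * t))) (Ioi 0) := by
  have := integrableOn_rpow_mul_exp_neg_mul_rpow (p := 1) (s := -(1/2)) (b := 1/4) (by norm_num) (by norm_num) (by norm_num)
  simp only [rpow_one] at this
  exact this.const_mul 2

lemma gL_int : IntegrableOn gL (Ioi 0) := by
  refine Integrable.mono' gL_bound_int (gL_cont.aestronglyMeasurable measurableSet_Ioi) ?_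
  refine (ae_restrict_iff' measurableSet_Ioi).mpr (ae_of_all _ fun t ht => ?_)
  rw [Real.norm_of_nonneg (gL_pos ht).le]
  exact gL_le ht

lemma I_eq : I = ∫ t in Ioi 0, gL t := setIntegral_congr_fun measurableSet_Ioi fun _ ht => gL_eq ht

lemma I_pos : 0 < I := by
  rw [I_eq, setIntegral_pos_iff_support_of_nonneg_ae]
  · have : Function.support gL ∩ Ioi 0 = Ioi 0 := by
      rw [inter_eq_right]
      intro t ht
      exact (gL_pos ht).ne'
    rw [this]; simp
  · exact (ae_restrict_iff' measurableSet_Ioi).mpr (ae_of_all _ fun t ht => (gL_pos ht).le)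
  · exact gL_int

lemma tgL_le {t : ℝ} (ht : 0 < t) : t * gL t ≤ 2 * (t ^ (1/2 : ℝ) * exp (-(1/4) * t)) := by
  calc t * gL t ≤ t * (2 * (t ^ (-(1/2) : ℝ) * exp (-(1/4) * t))) := by gcongr; exact gL_le ht
    _ = 2 * ((t ^ (1:ℝ) * t ^ (-(1/2) : ℝ)) * exp (-(1/4) * t)) := by rw [rpow_one]; ring
    _ = _ := by rw [← rpow_add ht]; norm_num

lemma dL_cont : ContinuousOn dL (Ioi 0) := by
  intro t ht
  have h1 := om_pos ht
  have h2 := oml_pos ht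
  have h3 : ContinuousAt (fun t : ℝ => 1 - exp (-t)) t := by fun_prop
  refine ContinuousAt.continuousWithinAt ?_
  unfold dL
  exact (((by fun_prop : ContinuousAt (fun t : ℝ => exp (-t)) t).div h3 h1.ne').div (continuousAt_const.sub (h3.log h1.ne')) (by linarith))

lemma exp_half_int : IntegrableOn (fun t : ℝ => exp (-(t / 2))) (Ioi 0) := by
  have := integrableOn_exp_mul_Ioi (a := -(1/2)) (by norm_num) 0
  refine this.congr_fun (fun t _ => ?_) measurableSet_Ioi
  ring_nf

lemma tdL_int : IntegrableOn (fun t => t * dL t) (Ioi 0) := by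
  refine Integrable.mono' exp_half_int ((continuousOn_id.mul dL_cont).aestronglyMeasurable measurableSet_Ioi) ?_
  refine (ae_restrict_iff' measurableSet_Ioi).mpr (ae_of_all _ fun t ht => ?_)
  rw [Real.norm_of_nonneg (mul_nonneg (le_of_lt ht) (dL_nonneg ht))]
  exact tdL_le ht

lemma I_eq_tdL : ∫ t in Ioi 0, t * dL t = I := by
  have h := integral_Ioi_of_hasDerivAt_of_tendsto (a := 0) (m := 0) (f := fun t => t * gL t) (f' := fun t => gL t - t * dL t) ?_ ?_ ?_ ?_
  · rw [integral_sub gL_int tdL_int, ← I_eq] at h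
    simp at h
    linarith
  · have h0 : Tendsto (fun t : ℝ => 2 * (t ^ (1/2 : ℝ) * exp (-(1/4) * t))) (𝓝[Ici 0] 0) (𝓝 0) := by
      have : ContinuousAt (fun t : ℝ => 2 * (t ^ (1/2 : ℝ) * exp (-(1/4) * t))) 0 := by
        have := continuousAt_rpow_const 0 (1/2 : ℝ) (Or.inr (by norm_num))
        fun_prop
      have h2 := this.tendsto
      rw [zero_rpow (by norm_num)] at h2
      simp only [zero_mul, mul_zero] at h2
      exact h2.mono_left nhdsWithin_le_nhds
    unfold ContinuousWithinAt
    simp only [zero_mul]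
    refine tendsto_of_tendsto_of_tendsto_of_le_of_le' tendsto_const_nhds h0 ?_ ?_
    · filter_upwards [self_mem_nhdsWithin] with t ht
      rcases eq_or_lt_of_le (show 0 ≤ t from ht) with h | h
      · rw [← h]; simp
      · exact mul_nonneg h.le (gL_pos h).le
    · filter_upwards [self_mem_nhdsWithin] with t ht
      rcases eq_or_lt_of_le (show 0 ≤ t from ht) with h | h
      · rw [← h]; simp
      · exact tgL_le h
  · intro t ht
    have := (hasDerivAt_id t).mul (gL_hasDeriv ht)
    refine this.congr_deriv ?_
    simp; ring
  · exact gL_int.sub tdL_int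
  · have h0 : Tendsto (fun t : ℝ => 2 * (t ^ (1/2 : ℝ) * exp (-(1/4) * t))) atTop (𝓝 (2 * 0)) :=
      (tendsto_rpow_mul_exp_neg_mul_atTop_nhds_zero (1/2) (1/4) (by norm_num)).const_mul 2
    rw [mul_zero] at h0
    refine tendsto_of_tendsto_of_tendsto_of_le_of_le' tendsto_const_nhds h0 ?_ ?_
    · filter_upwards [eventually_gt_atTop 0] with t ht using mul_nonneg ht.le (gL_pos ht).le
    · filter_upwards [eventually_gt_atTop 0] with t ht using tgL_le ht

lemma gL_tend : Tendsto gL atTop (𝓝 0) := by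
  have h0 : Tendsto (fun t : ℝ => 2 * (t ^ (-(1/2) : ℝ) * exp (-(1/4) * t))) atTop (𝓝 (2 * 0)) :=
      (tendsto_rpow_mul_exp_neg_mul_atTop_nhds_zero (-(1/2)) (1/4) (by norm_num)).const_mul 2
  rw [mul_zero] at h0
  refine tendsto_of_tendsto_of_tendsto_of_le_of_le' tendsto_const_nhds h0 ?_ ?_
  · filter_upwards [eventually_gt_atTop 0] with t ht using (gL_pos ht).le
  · filter_upwards [eventually_gt_atTop 0] with t ht using gL_le ht

lemma dL_int {a : ℝ} (ha : 0 < a) : IntegrableOn dL (Ioi a) := by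
  have h := integrableOn_Ioi_deriv_of_nonpos' (a := a) (g := gL) (g' := fun t => -dL t) (l := 0)
    (fun x hx => gL_hasDeriv (ha.trans_le hx)) (fun x hx => neg_nonpos.mpr (dL_nonneg (ha.trans hx))) gL_tend
  simpa using h.neg

lemma gL_layer {a : ℝ} (ha : 0 < a) : gL a = ∫ t in Ioi a, dL t := by
  have h := integral_Ioi_of_hasDerivAt_of_tendsto' (a := a) (m := 0) (f := gL) (f' := fun t => -dL t)
    (fun x hx => gL_hasDeriv (ha.trans_le hx)) (dL_int ha).neg gL_tend
  rw [integral_neg] at h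
  linarith
end Ana

section Ana
open Real Set Filter Topology MeasureTheory Chebyshev

lemma thdL_int {N : ℝ} (hN : 0 < N) : IntegrableOn (fun t => theta (t * N) * dL t) (Ioi 0) := by
  refine Integrable.mono' (tdL_int.const_mul (log 4 * N)) ?_ ?_
  · have : Measurable (theta) := theta_mono.measurable
    exact (this.comp (measurable_id.mul_const N)).aestronglyMeasurable.mul (dL_cont.aestronglyMeasurable measurableSet_Ioi)
  · refine (ae_restrict_iff' measurableSet_Ioi).mpr (ae_of_all _ fun t ht => ?_)
    have ht' : 0 < t := ht
    rw [Real.norm_of_nonneg (mul_nonneg (theta_nonneg _) (dL_nonneg ht)), ← mul_assoc]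
    refine mul_le_mul_of_nonneg_right ?_ (dL_nonneg ht)
    refine (theta_le_log4_mul_x (by positivity)).trans (le_of_eq (by ring))

lemma up_sum {N : ℝ} (hN : 0 < N) {S : Finset ℕ} (hS : ∀ p ∈ S, p.Prime) :
    ∑ p ∈ S, log p * gL (p / N) ≤ ∫ t in Ioi 0, theta (t * N) * dL t := by
  have hp0 : ∀ p ∈ S, 0 < (p : ℝ) / N := fun p hp => div_pos (by exact_mod_cast (hS p hp).pos) hN
  have hint : ∀ p ∈ S, IntegrableOn (fun t => log p * (Ioi ((p : ℝ) / N)).indicator dL t) (Ioi 0) := by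
    intro p hp
    refine Integrable.const_mul ?_ _
    refine ((integrable_indicator_iff measurableSet_Ioi).mpr (dL_int (hp0 p hp))).integrableOn
  have e1 : ∑ p ∈ S, log p * gL (p / N) = ∫ t in Ioi 0, ∑ p ∈ S, log p * (Ioi ((p : ℝ) / N)).indicator dL t := by
    rw [integral_finsetSum _ hint]
    refine Finset.sum_congr rfl fun p hp => ?_
    rw [integral_const_mul, setIntegral_indicator measurableSet_Ioi, gL_layer (hp0 p hp),
      inter_eq_right.mpr (Ioi_subset_Ioi (hp0 p hp).le)]
  rw [e1]
  refine setIntegral_mono_on (integrable_finsetSum _ hint) (thdL_int hN) measurableSet_Ioi fun t ht => ?_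
  have ht' : 0 < t := ht
  have e2 : ∑ p ∈ S, log p * (Ioi ((p : ℝ) / N)).indicator dL t = (∑ p ∈ S.filter (fun p : ℕ => (p : ℝ) / N < t), log p) * dL t := by
    rw [Finset.sum_filter, Finset.sum_mul]
    refine Finset.sum_congr rfl fun p _ => ?_
    by_cases h : (p : ℝ) / N < t <;> simp [indicator, h]
  rw [e2]
  refine mul_le_mul_of_nonneg_right ?_ (dL_nonneg ht)
  rw [theta]
  refine Finset.sum_le_sum_of_subset_of_nonneg ?_ fun p hp _ => log_natCast_nonneg p
  intro p hp
  rw [Finset.mem_filter] at hp ⊢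
  refine ⟨Finset.mem_Ioc.mpr ⟨(hS p hp.1).pos, ?_⟩, hS p hp.1⟩
  rw [Nat.le_floor_iff (by positivity)]
  exact ((div_lt_iff₀ hN).mp hp.2).le

lemma up_tend : Tendsto (fun N : ℝ => (∫ t in Ioi 0, theta (t * N) * dL t) / N) atTop (𝓝 I) := by
  rw [← I_eq_tdL]
  have : Tendsto (fun N : ℝ => ∫ t in Ioi 0, theta (t * N) / N * dL t) atTop (𝓝 (∫ t in Ioi 0, t * dL t)) := by
    refine tendsto_integral_filter_of_dominated_convergence (fun t => log 4 * (t * dL t)) ?_ ?_ (tdL_int.const_mul _) ?_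
    · filter_upwards [eventually_gt_atTop 0] with N hN
      have := ((thdL_int hN).div_const N).aestronglyMeasurable
      refine this.congr (ae_of_all _ fun t => ?_)
      ring
    · filter_upwards [eventually_gt_atTop 0] with N hN
      refine (ae_restrict_iff' measurableSet_Ioi).mpr (ae_of_all _ fun t ht => ?_)
      have ht' : 0 < t := ht
      rw [Real.norm_of_nonneg (mul_nonneg (div_nonneg (theta_nonneg _) hN.le) (dL_nonneg ht)), ← mul_assoc]
      exact mul_le_mul_of_nonneg_right (theta_scale_le ht'.le hN) (dL_nonneg ht)
    · refine (ae_restrict_iff' measurableSet_Ioi).mpr (ae_of_all _ fun t ht => ?_)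
      exact (theta_scale t ht).mul_const _
  refine this.congr fun N => ?_
  rw [← integral_div]
  congr 1
  funext t
  ring

noncomputable def lG (J : ℕ) (t : ℝ) : ℝ := log (GJ J t)
noncomputable def pG (J : ℕ) (t : ℝ) : ℝ := t * (HJ J t / GJ J t)

lemma GJ_hasDeriv (J : ℕ) (t : ℝ) : HasDerivAt (GJ J) (-HJ J t) t := by
  have : HasDerivAt (fun t => ∑ j ∈ Finset.range (J + 1), wj j * exp (-(j * t)))
      (∑ j ∈ Finset.range (J + 1), wj j * (exp (-(j * t)) * (-(j * 1)))) t := by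
    refine HasDerivAt.fun_sum fun j _ => ?_
    exact ((((hasDerivAt_id t).const_mul (j : ℝ)).neg).exp).const_mul _
  refine this.congr_deriv ?_
  rw [HJ, ← Finset.sum_neg_distrib]
  refine Finset.sum_congr rfl fun j _ => ?_
  ring

lemma GJ_contDiff (J : ℕ) : ContDiff ℝ 1 (GJ J) := by unfold GJ; fun_prop
lemma HJ_contDiff (J : ℕ) : ContDiff ℝ 1 (HJ J) := by unfold HJ; fun_prop
lemma lG_contDiff (J : ℕ) : ContDiff ℝ 1 (lG J) := (GJ_contDiff J).log fun t => (GJ_pos J t).ne'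
lemma pG_contDiff (J : ℕ) : ContDiff ℝ 1 (pG J) :=
  contDiff_id.mul ((HJ_contDiff J).div (GJ_contDiff J) fun t => (GJ_pos J t).ne')

lemma GJ_eq (J : ℕ) (t : ℝ) : GJ J t = 1 + ∑ i ∈ Finset.range J, exp (-t) ^ (i + 1) / ((i : ℝ) + 1) := by
  rw [GJ, Finset.sum_range_succ', add_comm]
  congr 1
  · simp [wj]
  · refine Finset.sum_congr rfl fun i _ => ?_
    rw [wj, if_neg (by omega), ← exp_nat_mul]
    push_cast
    ring_nf

lemma GJ_one_le (J : ℕ) (t : ℝ) : 1 ≤ GJ J t := by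
  rw [GJ_eq]
  have : 0 ≤ ∑ i ∈ Finset.range J, exp (-t) ^ (i + 1) / ((i : ℝ) + 1) := Finset.sum_nonneg fun i _ => by positivity
  linarith

lemma lG_nonneg (J : ℕ) (t : ℝ) : 0 ≤ lG J t := log_nonneg (GJ_one_le J t)

lemma pG_nonneg (J : ℕ) (t : ℝ) (ht : 0 < t) : 0 ≤ pG J t := by
  refine mul_nonneg ht.le (div_nonneg ?_ (GJ_pos J t).le)
  unfold HJ
  exact Finset.sum_nonneg fun j _ => mul_nonneg (by positivity) (mul_nonneg (wj_pos j).le (exp_pos _).le)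

lemma hsumL {t : ℝ} (ht : 0 < t) : HasSum (fun i : ℕ => exp (-t) ^ (i + 1) / ((i : ℝ) + 1)) (-log (1 - exp (-t))) := by
  refine hasSum_pow_div_log_of_abs_lt_one ?_
  rw [abs_of_pos (exp_pos _)]
  linarith [om_pos ht]

lemma lG_le {J : ℕ} {t : ℝ} (ht : 0 < t) : lG J t ≤ gL t := by
  refine log_le_log (GJ_pos J t) ?_
  rw [GJ_eq]
  have := sum_le_hasSum (Finset.range J) (fun i _ => by positivity) (hsumL ht)
  linarith

lemma lG_tend {t : ℝ} (ht : 0 < t) : Tendsto (fun J => lG J t) atTop (𝓝 (gL t)) := by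
  have h := ((hsumL ht).tendsto_sum_nat.const_add 1)
  have h2 := h.log (by linarith [oml_pos ht])
  rw [gL, sub_eq_add_neg]
  refine h2.congr fun J => ?_
  rw [lG, GJ_eq]

noncomputable def aJ (J : ℕ) : ℝ := ∫ t in ((J:ℝ)⁻¹)..(J:ℝ), lG J t
noncomputable def bJ (J : ℕ) : ℝ := ∫ t in ((J:ℝ)⁻¹)..(J:ℝ), pG J t

lemma inv_le_self_nat {J : ℕ} (hJ : 0 < J) : (J:ℝ)⁻¹ ≤ J := by
  have : (1:ℝ) ≤ J := by exact_mod_cast hJ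
  exact (inv_le_one_of_one_le₀ this).trans this

lemma aJ_tend : Tendsto aJ atTop (𝓝 I) := by
  have h : Tendsto (fun J : ℕ => ∫ t in Ioi 0, (Ioc ((J:ℝ)⁻¹) (J:ℝ)).indicator (lG J) t) atTop (𝓝 (∫ t in Ioi 0, gL t)) := by
    refine tendsto_integral_filter_of_dominated_convergence gL ?_ ?_ gL_int ?_
    · exact Eventually.of_forall fun J => ((lG_contDiff J).continuous.aestronglyMeasurable.indicator measurableSet_Ioc)
    · refine Eventually.of_forall fun J => (ae_restrict_iff' measurableSet_Ioi).mpr (ae_of_all _ fun t ht => ?_)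
      refine (norm_indicator_le_norm_self _ _).trans ?_
      rw [Real.norm_of_nonneg (lG_nonneg J t)]
      exact lG_le ht
    · refine (ae_restrict_iff' measurableSet_Ioi).mpr (ae_of_all _ fun t ht => ?_)
      refine (lG_tend ht).congr' ?_
      have h1 : ∀ᶠ J : ℕ in atTop, (J:ℝ)⁻¹ < t :=
        (tendsto_inv_atTop_zero.comp tendsto_natCast_atTop_atTop).eventually_lt_const ht
      have h2 : ∀ᶠ J : ℕ in atTop, t ≤ J := tendsto_natCast_atTop_atTop.eventually_ge_atTop t
      filter_upwards [h1, h2] with J h3 h4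
      rw [indicator_of_mem (show t ∈ Ioc ((J:ℝ)⁻¹) (J:ℝ) from ⟨h3, h4⟩)]
  rw [I_eq]
  refine h.congr' ?_
  filter_upwards [eventually_gt_atTop 0] with J hJ
  rw [aJ, intervalIntegral.integral_of_le (inv_le_self_nat hJ), setIntegral_indicator measurableSet_Ioc,
    inter_eq_right.mpr]
  intro t ht
  exact lt_trans (by positivity) ht.1

lemma bJ_eq (J : ℕ) : bJ J = aJ J + (J:ℝ)⁻¹ * lG J (J:ℝ)⁻¹ - J * lG J J := by
  have hd : ∀ t, HasDerivAt (fun t => t * lG J t) (lG J t - pG J t) t := by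
    intro t
    have := (hasDerivAt_id t).mul ((GJ_hasDeriv J t).log (GJ_pos J t).ne')
    refine this.congr_deriv ?_
    simp only [id, lG, pG]
    ring
  have h := intervalIntegral.integral_eq_sub_of_hasDerivAt (a := (J:ℝ)⁻¹) (b := J) (fun t _ => hd t)
    (((lG_contDiff J).continuous.sub (pG_contDiff J).continuous).intervalIntegrable _ _)
  rw [intervalIntegral.integral_sub ((lG_contDiff J).continuous.intervalIntegrable _ _) ((pG_contDiff J).continuous.intervalIntegrable _ _)] at h
  rw [bJ, aJ]
  linarith

lemma bJ_tend : Tendsto bJ atTop (𝓝 I) := by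
  have hb : ∀ t : ℝ, 0 < t → ∀ J, 0 ≤ t * lG J t ∧ t * lG J t ≤ 2 * (t ^ (1/2 : ℝ) * exp (-(1/4) * t)) := by
    intro t ht J
    refine ⟨mul_nonneg ht.le (lG_nonneg J t), le_trans ?_ (tgL_le ht)⟩
    gcongr
    exact lG_le ht
  have h0 : Tendsto (fun t : ℝ => 2 * (t ^ (1/2 : ℝ) * exp (-(1/4) * t))) (𝓝 0) (𝓝 0) := by
    have : ContinuousAt (fun t : ℝ => 2 * (t ^ (1/2 : ℝ) * exp (-(1/4) * t))) 0 := by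
      have := continuousAt_rpow_const 0 (1/2 : ℝ) (Or.inr (by norm_num))
      fun_prop
    have h2 := this.tendsto
    rw [zero_rpow (by norm_num)] at h2
    simpa only [zero_mul, mul_zero] using h2
  have hi : Tendsto (fun t : ℝ => 2 * (t ^ (1/2 : ℝ) * exp (-(1/4) * t))) atTop (𝓝 0) := by
    simpa using (tendsto_rpow_mul_exp_neg_mul_atTop_nhds_zero (1/2) (1/4) (by norm_num)).const_mul 2
  have h1 : Tendsto (fun J : ℕ => (J:ℝ)⁻¹ * lG J (J:ℝ)⁻¹) atTop (𝓝 0) := by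
    refine tendsto_of_tendsto_of_tendsto_of_le_of_le' tendsto_const_nhds
      (h0.comp (tendsto_inv_atTop_zero.comp tendsto_natCast_atTop_atTop)) ?_ ?_
    · filter_upwards [eventually_gt_atTop 0] with J hJ using (hb _ (by positivity) J).1
    · filter_upwards [eventually_gt_atTop 0] with J hJ using (hb _ (by positivity) J).2
  have h2 : Tendsto (fun J : ℕ => (J:ℝ) * lG J (J:ℝ)) atTop (𝓝 0) := by
    refine tendsto_of_tendsto_of_tendsto_of_le_of_le' tendsto_const_nhds
      (hi.comp tendsto_natCast_atTop_atTop) ?_ ?_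
    · filter_upwards [eventually_gt_atTop 0] with J hJ using (hb _ (by positivity) J).1
    · filter_upwards [eventually_gt_atTop 0] with J hJ using (hb _ (by positivity) J).2
  have := (aJ_tend.add h1).sub h2
  simp only [add_zero, sub_zero] at this
  exact this.congr fun J => (bJ_eq J).symm
end Ana

section Fin1
open Real Set Filter Topology

noncomputable def LL (n : ℕ) : ℝ := log n
noncomputable def NN (n : ℕ) : ℝ := (n * LL n / (3 * I)) ^ ((1:ℝ)/3)
noncomputable def RR (n : ℕ) : ℝ := NN n / LL n
noncomputable def EE (n : ℕ) : ℝ := (∑ f : Fin n → Fin n, (T f : ℝ)) / (n : ℝ) ^ n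

lemma LL_tend : Tendsto LL atTop atTop := tendsto_log_atTop.comp tendsto_natCast_atTop_atTop

lemma LL_pos {n : ℕ} (hn : 2 ≤ n) : 0 < LL n := log_pos (by exact_mod_cast hn)

lemma NN_base_pos {n : ℕ} (hn : 2 ≤ n) : 0 < n * LL n / (3 * I) := by
  have := LL_pos hn
  have := I_pos
  positivity

lemma NN_pos {n : ℕ} (hn : 2 ≤ n) : 0 < NN n := rpow_pos_of_pos (NN_base_pos hn) _

lemma RR_pos {n : ℕ} (hn : 2 ≤ n) : 0 < RR n := div_pos (NN_pos hn) (LL_pos hn)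

lemma NN_cube {n : ℕ} (hn : 2 ≤ n) : 3 * I * NN n ^ 3 = n * LL n := by
  rw [NN, ← rpow_natCast, ← rpow_mul (NN_base_pos hn).le]
  norm_num
  have := I_pos
  field_simp

lemma NN_tend : Tendsto NN atTop atTop := by
  refine (tendsto_rpow_atTop (by norm_num)).comp ?_
  exact (tendsto_natCast_atTop_atTop.atTop_mul_atTop₀ LL_tend).atTop_div_const (by have := I_pos; positivity)

lemma logdiv_tend : Tendsto (fun x : ℝ => log x / x) atTop (𝓝 0) := by
  simpa using Real.isLittleO_log_id_atTop.tendsto_div_nhds_zero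

lemma LLlog_tend : Tendsto (fun n => log (LL n) / LL n) atTop (𝓝 0) := logdiv_tend.comp LL_tend

lemma logN_tend : Tendsto (fun n => log (NN n) / LL n) atTop (𝓝 (1/3)) := by
  have h : Tendsto (fun n => (1/3) * (1 + log (LL n) / LL n - log (3 * I) / LL n)) atTop (𝓝 ((1/3) * (1 + 0 - 0))) :=
    ((tendsto_const_nhds.add LLlog_tend).sub (tendsto_const_nhds.div_atTop LL_tend)).const_mul _
  norm_num at h
  norm_num
  refine h.congr' ?_
  filter_upwards [eventually_ge_atTop 2] with n hn
  have hl := LL_pos hn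
  have hi := I_pos
  have hn' : (0:ℝ) < n := by positivity
  rw [NN, log_rpow (NN_base_pos hn), log_div (by positivity) (by positivity), log_mul hn'.ne' hl.ne']
  change _ = 1 / 3 * (LL n + log (LL n) - log (3 * I)) / LL n
  field_simp

lemma Lpow_tend (k : ℕ) : Tendsto (fun n => LL n ^ k / NN n) atTop (𝓝 0) := by
  have h1 : Tendsto (fun x : ℝ => log x ^ k / x) atTop (𝓝 0) := by
    simpa using (isLittleO_pow_log_id_atTop (n := k)).tendsto_div_nhds_zero
  have h2 := (h1.comp NN_tend).const_mul (6 ^ k)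
  rw [mul_zero] at h2
  refine tendsto_of_tendsto_of_tendsto_of_le_of_le' tendsto_const_nhds h2 ?_ ?_
  · filter_upwards [eventually_ge_atTop 2] with n hn
    have := LL_pos hn
    have := NN_pos hn
    positivity
  · filter_upwards [eventually_ge_atTop 2, logN_tend.eventually_const_lt (show (1/6:ℝ) < 1/3 by norm_num)] with n hn h
    have hl := LL_pos hn
    have hN := NN_pos hn
    rw [lt_div_iff₀ hl] at h
    simp only [Function.comp_apply]
    rw [← mul_div_assoc, ← mul_pow]
    gcongr
    linarith

lemma target_eq {n : ℕ} (hn : 2 ≤ n) : k0 * ((n:ℝ) / (log n) ^ 2) ^ ((1:ℝ)/3) = 9/2 * I * RR n := by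
  have hl := LL_pos hn
  have hi := I_pos
  have hn' : (0:ℝ) < n := by positivity
  change k0 * ((n:ℝ) / (LL n) ^ 2) ^ ((1:ℝ)/3) = 9/2 * I * RR n
  have e1 : (n:ℝ) / (LL n) ^ 2 = (n * LL n / (3 * I)) * (3 * I) / (LL n) ^ 3 := by field_simp
  have e2 : ((LL n) ^ 3) ^ ((1:ℝ)/3) = LL n := by
    rw [← rpow_natCast, ← rpow_mul hl.le]; norm_num
  rw [e1, div_rpow (by positivity) (by positivity), mul_rpow (by positivity) (by positivity), e2, RR, NN, k0]
  have e3 : (3 * I) ^ ((2:ℝ)/3) * (3 * I) ^ ((1:ℝ)/3) = 3 * I := by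
    rw [← rpow_add (by positivity)]; norm_num
  generalize (n * LL n / (3 * I)) ^ ((1:ℝ)/3) = q
  calc _ = 3/2 * ((3 * I) ^ ((2:ℝ)/3) * (3 * I) ^ ((1:ℝ)/3)) * (q / LL n) := by ring
    _ = _ := by rw [e3]; ring

lemma EE_ge {n : ℕ} (hn : 2 ≤ n) : 1 ≤ EE n := by
  have hnn : (0:ℝ) < (n : ℝ) ^ n := by positivity
  rw [EE, one_le_div hnn]
  calc (n : ℝ) ^ n = ∑ f : Fin n → Fin n, (1 : ℝ) := by simp
    _ ≤ _ := Finset.sum_le_sum fun f _ => by exact_mod_cast (T_mem f).1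

lemma lower (J : ℕ) (hJ : 0 < J) : ∃ Lo : ℕ → ℝ, Tendsto Lo atTop (𝓝 (3 * aJ J + 3 * bJ J - 3/2 * bJ J ^ 2 / I)) ∧
    ∀ᶠ n in atTop, Lo n ≤ log (EE n) / RR n := by
  have hI := I_pos
  have hJr : (0:ℝ) < J := by exact_mod_cast hJ
  let P : ℕ → Finset ℕ := fun n => PP ((J:ℝ)⁻¹) J (NN n)
  let Sa : ℕ → ℝ := fun n => ∑ p ∈ P n, lG J (p / NN n)
  let Sb : ℕ → ℝ := fun n => ∑ p ∈ P n, pG J (p / NN n)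
  have hinv : Tendsto (fun n => (log (NN n) / LL n)⁻¹) atTop (𝓝 3) := by
    have := logN_tend.inv₀ (by norm_num)
    norm_num at this
    refine this.congr fun n => ?_
    rw [inv_div]
  have hev : ∀ᶠ n in atTop, 2 ≤ n ∧ 1 < NN n := (eventually_ge_atTop 2).and (NN_tend.eventually_gt_atTop 1)
  have hconv : ∀ S : ℕ → ℝ, ∀ c, Tendsto (fun n => S n * log (NN n) / NN n) atTop (𝓝 c) → Tendsto (fun n => S n / RR n) atTop (𝓝 (3 * c)) := by
    intro S c h
    have := hinv.mul h
    refine this.congr' ?_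
    filter_upwards [hev] with n ⟨h1, h2⟩
    have hl := LL_pos h1
    have hN := NN_pos h1
    have hlN := log_pos h2
    rw [RR]
    field_simp
  have hSa : Tendsto (fun n => Sa n / RR n) atTop (𝓝 (3 * aJ J)) := hconv Sa _
    ((sum_prime_tendsto' (lG_contDiff J) (by positivity) (inv_le_self_nat hJ) (fun t _ => lG_nonneg J t)).comp NN_tend)
  have hSb : Tendsto (fun n => Sb n / RR n) atTop (𝓝 (3 * bJ J)) := hconv Sb _
    ((sum_prime_tendsto' (pG_contDiff J) (by positivity) (inv_le_self_nat hJ) (fun t ht => pG_nonneg J t ht)).comp NN_tend)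
  refine ⟨fun n => Sa n / RR n + Sb n / RR n - (Sb n / RR n) ^ 2 / (6 * I) - (J:ℝ) ^ 5 / (6 * I) * (LL n ^ 2 / NN n)
    - (J:ℝ) ^ 9 / (9 * I ^ 2) * (LL n ^ 3 / NN n) - 2 * (LL n ^ 2 / NN n), ?_, ?_⟩
  · have := ((((hSa.add hSb).sub ((hSb.pow 2).div_const (6 * I))).sub ((Lpow_tend 2).const_mul ((J:ℝ) ^ 5 / (6 * I)))).sub
      ((Lpow_tend 3).const_mul ((J:ℝ) ^ 9 / (9 * I ^ 2)))).sub ((Lpow_tend 2).const_mul 2)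
    convert this using 2
    field_simp
    ring
  · filter_upwards [eventually_ge_atTop 2, NN_tend.eventually_gt_atTop ((J:ℝ)^2),
      (Lpow_tend 1).eventually_lt_const (show 0 < 3 * I / (2 * (J:ℝ)^3) by positivity)] with n hn hNJ hLN
    have hl := LL_pos hn
    have hN := NN_pos hn
    have hR := RR_pos hn
    have hcube := NN_cube hn
    have hn0 : (0:ℝ) < n := by positivity
    have hmem : ∀ p ∈ P n, (J:ℝ)⁻¹ * NN n < p ∧ (p : ℝ) ≤ J * NN n ∧ p.Prime := by
      intro p hp
      simp only [P, PP, Finset.mem_filter, Finset.mem_Ioc] at hp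
      exact ⟨(Nat.floor_lt (by positivity)).mp hp.1.1, (Nat.le_floor_iff (by positivity)).mp hp.1.2, hp.2⟩
    have hcard : ((P n).card : ℝ) ≤ J * NN n := by
      have h1 : (P n).card ≤ ⌊J * NN n⌋₊ := by
        refine (Finset.card_filter_le _ _).trans ?_
        rw [Nat.card_Ioc]; omega
      exact (Nat.cast_le.mpr h1).trans (Nat.floor_le (by positivity))
    have hsm : ∑ p ∈ P n, (p:ℝ) * J ≤ J ^ 3 * NN n ^ 2 := by
      calc ∑ p ∈ P n, (p:ℝ) * J ≤ ∑ p ∈ P n, (J * NN n) * J := by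
            refine Finset.sum_le_sum fun p hp => ?_
            have := (hmem p hp).2.1
            gcongr
        _ = (P n).card * ((J * NN n) * J) := by rw [Finset.sum_const, nsmul_eq_mul]
        _ ≤ (J * NN n) * ((J * NN n) * J) := by gcongr
        _ = _ := by ring
    have hV : ∑ p ∈ P n, ((p:ℝ) * J) ^ 2 ≤ J ^ 5 * NN n ^ 3 := by
      calc ∑ p ∈ P n, ((p:ℝ) * J) ^ 2 ≤ ∑ p ∈ P n, ((J * NN n) * J) ^ 2 := by
            refine Finset.sum_le_sum fun p hp => ?_
            have := (hmem p hp).2.1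
            gcongr
        _ = (P n).card * ((J * NN n) * J) ^ 2 := by rw [Finset.sum_const, nsmul_eq_mul]
        _ ≤ (J * NN n) * ((J * NN n) * J) ^ 2 := by gcongr
        _ = _ := by ring
    have h2s : 2 * ∑ p ∈ P n, p * J ≤ n := by
      have : 2 * ∑ p ∈ P n, (p:ℝ) * J ≤ n := by
        refine (mul_le_mul_of_nonneg_left hsm (by norm_num)).trans ?_
        rw [pow_one, div_lt_div_iff₀ hN (by positivity)] at hLN
        have : (2 * (J ^ 3 * NN n ^ 2)) * LL n ≤ n * LL n := by
          rw [← hcube]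
          nlinarith [sq_nonneg (NN n)]
        exact le_of_mul_le_mul_right this hl
      exact_mod_cast this
    have hJp : ∀ p ∈ P n, J < p := by
      intro p hp
      have h1 := (hmem p hp).1
      have h2 : (J:ℝ) < (J:ℝ)⁻¹ * NN n := by
        rw [inv_mul_eq_div, lt_div_iff₀ hJr]; nlinarith
      exact_mod_cast h2.trans h1
    have hmain := low_bound (by omega : 0 < n) (fun p hp => (hmem p hp).2.2) hJp hN h2s
    have es0 : ∑ p ∈ P n, (p:ℝ) * (HJ J (p / NN n) / GJ J (p / NN n)) = NN n * Sb n := by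
      simp only [Sb, pG]
      rw [Finset.mul_sum]
      refine Finset.sum_congr rfl fun p _ => ?_
      field_simp
    rw [es0, mul_div_cancel_left₀ _ hN.ne', Real.log_mul (by positivity) (by have := EE_ge hn; rw [EE] at this; linarith)] at hmain
    change Sa n + Sb n - _ - _ ≤ log (n + 1) + log (EE n) at hmain
    have hln : log ((n:ℝ) + 1) ≤ 2 * LL n := by
      have : (n:ℝ) + 1 ≤ (n:ℝ) ^ 2 := by
        have : (2:ℝ) ≤ n := by exact_mod_cast hn
        nlinarith
      calc log ((n:ℝ) + 1) ≤ log ((n:ℝ) ^ 2) := log_le_log (by positivity) this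
        _ = 2 * LL n := by rw [log_pow]; norm_num; rfl
    have hc1 : ((NN n * Sb n) ^ 2 + ∑ p ∈ P n, ((p:ℝ) * J) ^ 2) / (2 * n) ≤ ((NN n * Sb n) ^ 2 + J ^ 5 * NN n ^ 3) / (2 * n) := by
      gcongr
    have hc2 : (∑ p ∈ P n, (p:ℝ) * J) ^ 3 / (n:ℝ) ^ 2 ≤ (J ^ 3 * NN n ^ 2) ^ 3 / (n:ℝ) ^ 2 := by
      gcongr
    have hfinal : Sa n + Sb n - ((NN n * Sb n) ^ 2 + J ^ 5 * NN n ^ 3) / (2 * n) - (J ^ 3 * NN n ^ 2) ^ 3 / (n:ℝ) ^ 2 - 2 * LL n ≤ log (EE n) := by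
      linarith
    rw [le_div_iff₀ hR]
    refine le_trans (le_of_eq ?_) hfinal
    have hn_eq : (n:ℝ) = 3 * I * NN n ^ 3 / LL n := by rw [hcube]; field_simp
    rw [hn_eq, RR]
    field_simp
    ring
end Fin1

section Fin2
open Real Set Filter Topology MeasureTheory Chebyshev

lemma xpow (N : ℝ) (k : ℕ) : exp (-1 / N) ^ k = exp (-(k / N)) := by
  rw [← exp_nat_mul]; congr 1; ring

lemma kset_le {y i : ℕ} (hi : 0 < i) (hiy : i ≤ y ^ 2) {N : ℝ} (hN : 0 < N) :
    log (1 + ∑ k ∈ kset y i, ((i:ℝ) / k) * exp (-1 / N) ^ k) ≤ gL (i / N) := by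
  have hi' : (0:ℝ) < i := by exact_mod_cast hi
  have ht : 0 < (i:ℝ) / N := by positivity
  rw [gL]
  refine log_le_log ?_ ?_
  · have : 0 ≤ ∑ k ∈ kset y i, ((i:ℝ) / k) * exp (-1 / N) ^ k := Finset.sum_nonneg fun k _ => by positivity
    linarith
  · rw [sub_eq_add_neg]
    gcongr
    have hsub : kset y i ⊆ (Finset.range (y ^ 2)).image (fun j => i * (j + 1)) := by
      intro k hk
      rw [kset, if_pos hiy, Finset.mem_filter, Finset.mem_Icc] at hk
      obtain ⟨⟨h1, h2⟩, c, rfl⟩ := hk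
      rw [Finset.mem_image]
      have hc : 0 < c := Nat.pos_of_mul_pos_left h1
      refine ⟨c - 1, ?_, by congr 1; omega⟩
      rw [Finset.mem_range]
      have : c ≤ i * c := Nat.le_mul_of_pos_left c hi
      omega
    refine (Finset.sum_le_sum_of_subset_of_nonneg hsub (fun _ _ _ => by positivity)).trans ?_
    rw [Finset.sum_image (by
      intro a _ b _ h
      have := Nat.eq_of_mul_eq_mul_left hi h
      omega)]
    refine le_trans (le_of_eq ?_) (sum_le_hasSum (Finset.range (y ^ 2)) (fun i _ => by positivity) (hsumL ht))
    refine Finset.sum_congr rfl fun j _ => ?_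
    rw [xpow, ← exp_nat_mul]
    push_cast
    have : -((i:ℝ) * (j + 1) / N) = (j + 1) * -(i / N) := by ring
    rw [this]
    field_simp

lemma upper_fin {n y : ℕ} (hn : 2 ≤ n) (hy : 2 ≤ y) {N : ℝ} (hN : 0 < N) :
    log (EE n) ≤ y * LL n + (1/2 + n / (2 * N ^ 2)) + (∫ t in Ioi 0, theta (t * N) * dL t) / log y
      + n * exp (-((y:ℝ) ^ 2 / N)) := by
  have hn0 : (0:ℝ) < n := by positivity
  have hEE : 0 < EE n := by linarith [EE_ge hn]
  have hE := E_le (y := y) (by omega : 0 < n) hN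
  have hfac : ∀ i ∈ iset y n, 0 < 1 + ∑ k ∈ kset y i, ((i:ℝ) / k) * exp (-1 / N) ^ k := by
    intro i _
    have : 0 ≤ ∑ k ∈ kset y i, ((i:ℝ) / k) * exp (-1 / N) ^ k := Finset.sum_nonneg fun k _ => by positivity
    linarith
  have h1 := log_le_log hEE hE
  rw [log_mul (by positivity) (Finset.prod_pos hfac).ne', log_mul (by positivity) (by positivity), log_exp, log_pow,
    log_prod fun i hi => (hfac i hi).ne'] at h1
  have hlogy : 0 < log y := log_pos (by exact_mod_cast hy)
  have hdis : Disjoint ((Finset.Ioc y (y ^ 2)).filter Nat.Prime) (Finset.Ioc (y ^ 2) n) := by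
    rw [Finset.disjoint_left]
    intro a ha hb
    rw [Finset.mem_filter, Finset.mem_Ioc] at ha
    rw [Finset.mem_Ioc] at hb
    omega
  rw [iset, Finset.sum_union hdis] at h1
  have h2 : ∑ i ∈ (Finset.Ioc y (y ^ 2)).filter Nat.Prime, log (1 + ∑ k ∈ kset y i, ((i:ℝ) / k) * exp (-1 / N) ^ k)
      ≤ (∫ t in Ioi 0, theta (t * N) * dL t) / log y := by
    rw [le_div_iff₀ hlogy]
    refine le_trans ?_ (up_sum hN (S := (Finset.Ioc y (y ^ 2)).filter Nat.Prime) (fun p hp => (Finset.mem_filter.mp hp).2))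
    rw [Finset.sum_mul]
    refine Finset.sum_le_sum fun i hi => ?_
    rw [Finset.mem_filter, Finset.mem_Ioc] at hi
    have hi0 : (0:ℝ) < i := by exact_mod_cast hi.2.pos
    rw [mul_comm]
    refine mul_le_mul (log_le_log (by positivity) (by exact_mod_cast hi.1.1.le)) (kset_le hi.2.pos hi.1.2 hN) ?_ (log_natCast_nonneg i)
    refine log_nonneg ?_
    have : 0 ≤ ∑ k ∈ kset y i, ((i:ℝ) / k) * exp (-1 / N) ^ k := Finset.sum_nonneg fun k _ => by positivity
    linarith
  have h3 : ∑ i ∈ Finset.Ioc (y ^ 2) n, log (1 + ∑ k ∈ kset y i, ((i:ℝ) / k) * exp (-1 / N) ^ k)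
      ≤ n * exp (-((y:ℝ) ^ 2 / N)) := by
    calc _ ≤ ∑ i ∈ Finset.Ioc (y ^ 2) n, exp (-((y:ℝ) ^ 2 / N)) := by
          refine Finset.sum_le_sum fun i hi => ?_
          rw [Finset.mem_Ioc] at hi
          have hi0 : (0:ℝ) < i := by exact_mod_cast (by omega : 0 < i)
          rw [kset, if_neg (by omega), Finset.sum_singleton, div_self hi0.ne', one_mul, xpow]
          have := log_le_sub_one_of_pos (show 0 < 1 + exp (-((i:ℝ) / N)) by positivity)
          refine le_trans (show _ ≤ exp (-((i:ℝ) / N)) by linarith) ?_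
          apply exp_le_exp.mpr
          have : (y:ℝ) ^ 2 ≤ i := by exact_mod_cast hi.1.le
          gcongr
      _ = ((n - y ^ 2 : ℕ) : ℝ) * exp (-((y:ℝ) ^ 2 / N)) := by rw [Finset.sum_const, Nat.card_Ioc, nsmul_eq_mul]
      _ ≤ _ := by
          gcongr
          omega
  change log (EE n) ≤ y * LL n + _ + _ at h1
  linarith

lemma upper : ∃ U : ℕ → ℝ, Tendsto U atTop (𝓝 (9/2 * I)) ∧ ∀ᶠ n in atTop, log (EE n) / RR n ≤ U n := by
  have hI := I_pos
  have hden : Tendsto (fun n => (log (NN n) / LL n - 3 * (log (LL n) / LL n) - log 2 / LL n)⁻¹) atTop (𝓝 3) := by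
    have := ((logN_tend.sub (LLlog_tend.const_mul 3)).sub (tendsto_const_nhds (x := log 2) |>.div_atTop LL_tend)).inv₀ (by norm_num)
    norm_num at this
    simpa using this
  have hLinv : Tendsto (fun n => 1 / LL n) atTop (𝓝 0) := tendsto_const_nhds.div_atTop LL_tend
  have hup := up_tend.comp NN_tend
  refine ⟨fun n => 1 / LL n + 1/2 * (LL n ^ 1 / NN n) + 3/2 * I +
    ((∫ t in Ioi 0, theta (t * NN n) * dL t) / NN n) * (log (NN n) / LL n - 3 * (log (LL n) / LL n) - log 2 / LL n)⁻¹ +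
    LL n ^ 1 / NN n, ?_, ?_⟩
  · have := (((hLinv.add ((Lpow_tend 1).const_mul (1/2))).add (tendsto_const_nhds (x := 3/2 * I))).add (hup.mul hden)).add (Lpow_tend 1)
    have e9 : 0 + 1 / 2 * 0 + 3 / 2 * I + I * 3 + 0 = 9/2 * I := by ring
    rw [e9] at this
    exact this
  · have hpos : ∀ᶠ n in atTop, 0 < log (NN n) / LL n - 3 * (log (LL n) / LL n) - log 2 / LL n := by
      have := ((logN_tend.sub (LLlog_tend.const_mul 3)).sub (tendsto_const_nhds (x := log 2) |>.div_atTop LL_tend))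
      exact this.eventually_const_lt (by norm_num)
    filter_upwards [eventually_ge_atTop 2, hpos, (Lpow_tend 3).eventually_lt_const (show (0:ℝ) < 1/4 by norm_num),
      (Lpow_tend 7).eventually_lt_const (show (0:ℝ) < 1/4 by norm_num)] with n hn hp h3 h7
    have hl := LL_pos hn
    have hN := NN_pos hn
    have hR := RR_pos hn
    have hcube := NN_cube hn
    have hn0 : (0:ℝ) < n := by positivity
    rw [div_lt_iff₀ hN] at h3 h7
    set z := NN n / LL n ^ 3 with hz
    have hz4 : 4 < z := by rw [hz, lt_div_iff₀ (by positivity)]; linarith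
    set y := ⌊z⌋₊ with hy
    have hyz : (y:ℝ) ≤ z := Nat.floor_le (by linarith)
    have hyz2 : z / 2 ≤ y := by
      have := Nat.lt_floor_add_one z
      rw [← hy] at this
      linarith
    have hy2 : 2 ≤ y := by
      have : (2:ℝ) ≤ y := by linarith
      exact_mod_cast this
    have hmain := upper_fin hn hy2 hN
    have hlogy : log (NN n) - 3 * log (LL n) - log 2 ≤ log y := by
      have : log (z / 2) = log (NN n) - 3 * log (LL n) - log 2 := by
        rw [log_div (by positivity) (by norm_num), hz, log_div hN.ne' (by positivity), log_pow]
        norm_num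
      rw [← this]
      exact log_le_log (by linarith) hyz2
    have hd : log (NN n) / LL n - 3 * (log (LL n) / LL n) - log 2 / LL n = (log (NN n) - 3 * log (LL n) - log 2) / LL n := by ring
    rw [hd] at hp ⊢
    have hp2 : 0 < log (NN n) - 3 * log (LL n) - log 2 := by
      have := mul_pos hp hl
      rwa [div_mul_cancel₀ _ hl.ne'] at this
    have hth : 0 ≤ ∫ t in Ioi 0, theta (t * NN n) * dL t :=
      setIntegral_nonneg measurableSet_Ioi fun t ht => mul_nonneg (theta_nonneg _) (dL_nonneg ht)
    have t1 : y * LL n ≤ z * LL n := by gcongr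
    have t2 : (∫ t in Ioi 0, theta (t * NN n) * dL t) / log y ≤ (∫ t in Ioi 0, theta (t * NN n) * dL t) / (log (NN n) - 3 * log (LL n) - log 2) := by
      gcongr
    have t3 : n * exp (-((y:ℝ) ^ 2 / NN n)) ≤ 1 := by
      have h1 : LL n ≤ (y:ℝ) ^ 2 / NN n := by
        rw [le_div_iff₀ hN]
        have h2 : (z / 2) ^ 2 ≤ (y:ℝ) ^ 2 := by gcongr
        refine le_trans ?_ h2
        rw [hz, div_div, div_pow, le_div_iff₀ (by positivity)]
        nlinarith
      calc n * exp (-((y:ℝ) ^ 2 / NN n)) ≤ n * exp (-LL n) := by gcongr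
        _ = 1 := by rw [exp_neg, LL, exp_log hn0, mul_inv_cancel₀ hn0.ne']
    have hfinal : log (EE n) ≤ z * LL n + (1/2 + n / (2 * NN n ^ 2)) +
      (∫ t in Ioi 0, theta (t * NN n) * dL t) / (log (NN n) - 3 * log (LL n) - log 2) + 1 := by linarith
    rw [div_le_iff₀ hR]
    refine hfinal.trans (le_of_eq ?_)
    have hn_eq : (n:ℝ) = 3 * I * NN n ^ 3 / LL n := by rw [hcube]; field_simp
    generalize (∫ t in Ioi 0, theta (t * NN n) * dL t) = Q
    generalize log (NN n) - 3 * log (LL n) - log 2 = D at *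
    rw [hn_eq, RR, hz]
    field_simp
    ring

theorem expected_value_T_aux :
    Filter.Tendsto (fun n : ℕ => Real.log ((∑ f : Fin n → Fin n, (T f : ℝ)) / (n : ℝ) ^ n)
      / (k0 * ((n : ℝ) / (Real.log n) ^ 2) ^ ((1 : ℝ) / 3))) Filter.atTop (nhds 1) := by
  have hI := I_pos
  have key : Tendsto (fun n => log (EE n) / RR n) atTop (𝓝 (9/2 * I)) := by
    rw [tendsto_order]
    constructor
    · intro c hc
      have hJ : Tendsto (fun J => 3 * aJ J + 3 * bJ J - 3/2 * bJ J ^ 2 / I) atTop (𝓝 (3 * I + 3 * I - 3/2 * I ^ 2 / I)) :=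
        ((aJ_tend.const_mul 3).add (bJ_tend.const_mul 3)).sub (((bJ_tend.pow 2).const_mul (3/2)).div_const I)
      have he : 3 * I + 3 * I - 3/2 * I ^ 2 / I = 9/2 * I := by field_simp; ring
      rw [he] at hJ
      obtain ⟨J, h1, h2⟩ := ((hJ.eventually_const_lt hc).and (eventually_gt_atTop 0)).exists
      obtain ⟨Lo, h3, h4⟩ := lower J h2
      filter_upwards [h3.eventually_const_lt h1, h4] with n h5 h6 using h5.trans_le h6
    · intro c hc
      obtain ⟨U, h3, h4⟩ := upper
      filter_upwards [h3.eventually_lt_const hc, h4] with n h5 h6 using h6.trans_lt h5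
  have h2 := key.div_const (9/2 * I)
  rw [div_self (by positivity)] at h2
  refine h2.congr' ?_
  filter_upwards [eventually_ge_atTop 2] with n hn
  rw [target_eq hn, div_div, mul_comm (RR n)]
  rfl
end Fin2

/-- `log E_n(T) = k₀·(n / log²n)^{1/3}·(1 + o(1))`. -/
theorem expected_value_T :
    Filter.Tendsto
      (fun n : ℕ =>
        Real.log ((∑ f : Fin n → Fin n, (T f : ℝ)) / (n : ℝ) ^ n) /
          (k0 * ((n : ℝ) / (Real.log n) ^ 2) ^ ((1 : ℝ) / 3)))
      Filter.atTop (nhds 1) := by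
  exact expected_value_T_aux

end IterMap
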